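/- arXiv:1006.2730 — 3 statements merged into one kernel-verified Lean document; each statement's English description precedes it below -/
import Mathlib

section
/- Let L > 0 and let ρ : ℝ → ℝ be continuous with ρ(x) > 0 for all x ∈ [−L, L]. Suppose (E₀, Ψ₀) is a fundamental Dirichlet eigenpair of the string: Ψ₀ is C² on [−L,L], not identically zero, −Ψ₀''(x) = E₀ ρ(x) Ψ₀(x) on [−L,L], Ψ₀(−L) = Ψ₀(L) = 0, ∫_{−L}^{L} ρ(x) Ψ₀(x)² dx = 1, and every other Dirichlet eigenvalue E of the string satisfies E > E₀. Let ξ₀ be continuous on [−L,L] with ∫_{−L}^{L} √(ρ(x)) Ψ₀(x) ξ₀(x) dx ≠ 0, and define recursively ξ_n(x) = √(ρ(x)) ∫_{−L}^{x} [κ_n − ∫_{−L}^{y} √(ρ(z)) ξ_{n−1}(z) dz] dy, where κ_n = (1/(2L)) ∫_{−L}^{L} ∫_{−L}^{y} √(ρ(z)) ξ_{n−1}(z) dz dy. Then, setting c_n = (∫_{−L}^{L} ξ_n(x)² dx)^{−1/2}, there exists a sign s ∈ {−1, 1} such that s · c_n · ξ_n(x)/√(ρ(x)) converges uniformly on [−L,L]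 to Ψ₀(x) as n → ∞. -/
open Real Set Filter intervalIntegral

/-- The iteration map of the paper: it sends a continuous function `ξ` on `[-L, L]`
to `x ↦ √(ρ x) · ∫_{-L}^{x} (κ - ∫_{-L}^{y} √(ρ z) ξ z dz) dy`, where the constant
`κ = (1/(2L)) ∫_{-L}^{L} ∫_{-L}^{y} √(ρ z) ξ z dz dy`. -/
noncomputable def stringIter (L : ℝ) (ρ ξ : ℝ → ℝ) : ℝ → ℝ := fun x =>
  Real.sqrt (ρ x) *
    ∫ y in (-L)..x,
      ((1 / (2 * L)) * ∫ u in (-L)..L, ∫ z in (-L)..u, Real.sqrt (ρ z) * ξ z) -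
        ∫ z in (-L)..y, Real.sqrt (ρ z) * ξ z

open scoped Topology

/-- The weighted inner product `∫_{-L}^{L} ρ f g`. -/
noncomputable def weightedInner (L : ℝ) (ρ f g : ℝ → ℝ) : ℝ :=
  ∫ x in (-L)..L, ρ x * f x * g x

/-- The slope at `-L` of the solution of `-u'' = ρ f`, `u (-L) = u L = 0`. -/
noncomputable def initialSlope (L : ℝ) (ρ f : ℝ → ℝ) : ℝ :=
  (1 / (2 * L)) * ∫ u in (-L)..L, ∫ z in (-L)..u, ρ z * f z

/-- The derivative of the solution of `-u'' = ρ f`, `u (-L) = u L = 0`. -/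
noncomputable def greenSlope (L : ℝ) (ρ f : ℝ → ℝ) (y : ℝ) : ℝ :=
  initialSlope L ρ f - ∫ z in (-L)..y, ρ z * f z

/-- The solution of `-u'' = ρ f`, `u (-L) = u L = 0`. -/
noncomputable def greenOp (L : ℝ) (ρ f : ℝ → ℝ) (x : ℝ) : ℝ :=
  ∫ y in (-L)..x, greenSlope L ρ f y

section Green

variable {L : ℝ} {ρ f g k : ℝ → ℝ}

lemma greenSlope_hasDerivAt (hρ : Continuous ρ) (hf : Continuous f) (x : ℝ) :
    HasDerivAt (greenSlope L ρ f) (-(ρ x * f x)) x :=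
  ((hρ.mul hf).integral_hasStrictDerivAt (-L) x).hasDerivAt.const_sub _

lemma greenSlope_continuous (hρ : Continuous ρ) (hf : Continuous f) :
    Continuous (greenSlope L ρ f) :=
  continuous_iff_continuousAt.2 fun x => (greenSlope_hasDerivAt hρ hf x).continuousAt

lemma greenOp_hasDerivAt (hρ : Continuous ρ) (hf : Continuous f) (x : ℝ) :
    HasDerivAt (greenOp L ρ f) (greenSlope L ρ f x) x :=
  ((greenSlope_continuous hρ hf).integral_hasStrictDerivAt (-L) x).hasDerivAt

lemma greenOp_continuous (hρ : Continuous ρ) (hf : Continuous f) :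
    Continuous (greenOp L ρ f) :=
  continuous_iff_continuousAt.2 fun x => (greenOp_hasDerivAt hρ hf x).continuousAt

lemma greenOp_left : greenOp L ρ f (-L) = 0 := by simp [greenOp]

lemma greenOp_right (hL : 0 < L) (hρ : Continuous ρ) (hf : Continuous f) :
    greenOp L ρ f L = 0 := by
  have hc : Continuous fun y => ∫ z in (-L)..y, ρ z * f z :=
    intervalIntegral.continuous_primitive (fun a b => (hρ.mul hf).intervalIntegrable a b) _
  simp only [greenOp, greenSlope]
  rw [intervalIntegral.integral_sub (by simp) (hc.intervalIntegrable _ _)]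
  simp only [intervalIntegral.integral_const, initialSlope, smul_eq_mul]
  field_simp
  ring

lemma greenSlope_left : greenSlope L ρ f (-L) = initialSlope L ρ f := by simp [greenSlope]

lemma uIcc_subset_Icc_symm {x : ℝ} (hx : x ∈ Icc (-L) L) : uIcc (-L) x ⊆ Icc (-L) L := by
  rw [uIcc_of_le hx.1]
  exact Icc_subset_Icc_right hx.2

lemma weightedInner_congr (hL : 0 < L) {f' g' : ℝ → ℝ} (hf : EqOn f f' (Icc (-L) L))
    (hg : EqOn g g' (Icc (-L) L)) : weightedInner L ρ f g = weightedInner L ρ f' g' := by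
  refine intervalIntegral.integral_congr fun x hx => ?_
  rw [uIcc_of_le (by linarith)] at hx
  simp only [hf hx, hg hx]

lemma weighted_primitive_congr {ρ' : ℝ → ℝ} (h : ∀ z ∈ Icc (-L) L, ρ z * f z = ρ' z * g z)
    {x : ℝ} (hx : x ∈ Icc (-L) L) :
    ∫ z in (-L)..x, ρ z * f z = ∫ z in (-L)..x, ρ' z * g z :=
  intervalIntegral.integral_congr fun z hz => h z (uIcc_subset_Icc_symm hx hz)

lemma initialSlope_congr (hL : 0 < L) {ρ' : ℝ → ℝ}
    (h : ∀ z ∈ Icc (-L) L, ρ z * f z = ρ' z * g z) :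
    initialSlope L ρ f = initialSlope L ρ' g := by
  unfold initialSlope
  congr 1
  refine intervalIntegral.integral_congr fun z hz => ?_
  rw [uIcc_of_le (by linarith)] at hz
  exact weighted_primitive_congr h hz

lemma greenSlope_congr (hL : 0 < L) {ρ' : ℝ → ℝ}
    (h : ∀ z ∈ Icc (-L) L, ρ z * f z = ρ' z * g z) :
    EqOn (greenSlope L ρ f) (greenSlope L ρ' g) (Icc (-L) L) := fun x hx => by
  unfold greenSlope
  rw [initialSlope_congr hL h, weighted_primitive_congr h hx]

lemma greenOp_congr (hL : 0 < L) {ρ' : ℝ → ℝ}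
    (h : ∀ z ∈ Icc (-L) L, ρ z * f z = ρ' z * g z) :
    EqOn (greenOp L ρ f) (greenOp L ρ' g) (Icc (-L) L) := fun _ hx =>
  intervalIntegral.integral_congr fun _ hz =>
    greenSlope_congr hL h (uIcc_subset_Icc_symm hx hz)

lemma stringIter_eq_greenOp (hL : 0 < L) (hpos : ∀ x ∈ Icc (-L) L, 0 < ρ x)
    (h : ∀ x ∈ Icc (-L) L, g x = √(ρ x) * f x) {x : ℝ} (hx : x ∈ Icc (-L) L) :
    stringIter L ρ g x = √(ρ x) * greenOp L ρ f x :=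
  congrArg (√(ρ x) * ·) <| greenOp_congr (ρ := fun z => √(ρ z)) (f := g) hL
    (fun z hz => by rw [h z hz, ← mul_assoc, Real.mul_self_sqrt (hpos z hz).le]) hx

lemma weightedInner_comm : weightedInner L ρ f g = weightedInner L ρ g f := by
  simp only [weightedInner, mul_right_comm]

lemma weightedInner_lin (hρ : Continuous ρ) (hf : Continuous f) (hg : Continuous g)
    (hk : Continuous k) (a b : ℝ) :
    weightedInner L ρ (fun x => a * f x + b * g x) k =
      a * weightedInner L ρ f k + b * weightedInner L ρ g k := by
  simp only [weightedInner]
  rw [← intervalIntegral.integral_const_mul, ← intervalIntegral.integral_const_mul,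
    ← intervalIntegral.integral_add]
  · exact intervalIntegral.integral_congr fun x _ => by ring
  all_goals exact Continuous.intervalIntegrable (by fun_prop) _ _

lemma weightedInner_lin_self (hρ : Continuous ρ) (hf : Continuous f) (hg : Continuous g)
    (a b : ℝ) :
    weightedInner L ρ (fun x => a * f x + b * g x) (fun x => a * f x + b * g x) =
      a ^ 2 * weightedInner L ρ f f + 2 * a * b * weightedInner L ρ f g +
        b ^ 2 * weightedInner L ρ g g := by
  rw [weightedInner_lin hρ hf hg (by fun_prop), weightedInner_comm (f := f),
    weightedInner_comm (f := g), weightedInner_lin hρ hf hg hf,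
    weightedInner_lin hρ hf hg hg, weightedInner_comm (f := g) (g := f)]
  ring

lemma weighted_primitive_lin (hρ : Continuous ρ) (hf : Continuous f) (hg : Continuous g)
    (a b x : ℝ) :
    ∫ z in (-L)..x, ρ z * (a * f z + b * g z) =
      a * (∫ z in (-L)..x, ρ z * f z) + b * ∫ z in (-L)..x, ρ z * g z := by
  rw [← intervalIntegral.integral_const_mul, ← intervalIntegral.integral_const_mul,
    ← intervalIntegral.integral_add]
  · exact intervalIntegral.integral_congr fun x _ => by ring
  all_goals exact Continuous.intervalIntegrable (by fun_prop) _ _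

lemma initialSlope_lin (hρ : Continuous ρ) (hf : Continuous f) (hg : Continuous g) (a b : ℝ) :
    initialSlope L ρ (fun x => a * f x + b * g x) =
      a * initialSlope L ρ f + b * initialSlope L ρ g := by
  have hc {h : ℝ → ℝ} (hh : Continuous h) : Continuous fun y => ∫ z in (-L)..y, ρ z * h z :=
    intervalIntegral.continuous_primitive (fun a b => (hρ.mul hh).intervalIntegrable a b) _
  simp only [initialSlope, weighted_primitive_lin hρ hf hg]
  rw [intervalIntegral.integral_add (((hc hf).const_mul a).intervalIntegrable _ _)
    (((hc hg).const_mul b).intervalIntegrable _ _), intervalIntegral.integral_const_mul,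
    intervalIntegral.integral_const_mul]
  ring

lemma greenSlope_lin (hρ : Continuous ρ) (hf : Continuous f) (hg : Continuous g) (a b x : ℝ) :
    greenSlope L ρ (fun x => a * f x + b * g x) x =
      a * greenSlope L ρ f x + b * greenSlope L ρ g x := by
  simp only [greenSlope, weighted_primitive_lin hρ hf hg, initialSlope_lin hρ hf hg]
  ring

lemma greenOp_lin (hρ : Continuous ρ) (hf : Continuous f) (hg : Continuous g) (a b x : ℝ) :
    greenOp L ρ (fun x => a * f x + b * g x) x =
      a * greenOp L ρ f x + b * greenOp L ρ g x := by
  simp only [greenOp, greenSlope_lin hρ hf hg]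
  rw [intervalIntegral.integral_add
    (((greenSlope_continuous hρ hf).const_mul a).intervalIntegrable _ _)
    (((greenSlope_continuous hρ hg).const_mul b).intervalIntegrable _ _),
    intervalIntegral.integral_const_mul, intervalIntegral.integral_const_mul]

lemma weightedInner_greenOp (hL : 0 < L) (hρ : Continuous ρ) (hf : Continuous f)
    (hg : Continuous g) :
    weightedInner L ρ (greenOp L ρ f) g =
      ∫ x in (-L)..L, greenSlope L ρ f x * greenSlope L ρ g x := by
  have h := intervalIntegral.integral_mul_deriv_eq_deriv_mul (a := -L) (b := L)
    (fun x _ => greenOp_hasDerivAt (L := L) hρ hf x)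
    (fun x _ => greenSlope_hasDerivAt (L := L) hρ hg x)
    ((greenSlope_continuous hρ hf).intervalIntegrable _ _)
    ((hρ.mul hg).neg.intervalIntegrable _ _)
  rw [greenOp_left, greenOp_right hL hρ hf] at h
  have h2 : weightedInner L ρ (greenOp L ρ f) g =
      -∫ x in (-L)..L, greenOp L ρ f x * -(ρ x * g x) := by
    rw [← intervalIntegral.integral_neg]
    exact intervalIntegral.integral_congr fun x _ => by ring
  rw [h2, h]
  ring

lemma weightedInner_greenOp_symm (hL : 0 < L) (hρ : Continuous ρ) (hf : Continuous f)
    (hg : Continuous g) :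
    weightedInner L ρ (greenOp L ρ f) g = weightedInner L ρ f (greenOp L ρ g) := by
  rw [weightedInner_greenOp hL hρ hf hg, weightedInner_comm, weightedInner_greenOp hL hρ hg hf]
  simp only [mul_comm]

lemma weightedInner_greenOp_self_nonneg (hL : 0 < L) (hρ : Continuous ρ) (hf : Continuous f) :
    0 ≤ weightedInner L ρ (greenOp L ρ f) f := by
  rw [weightedInner_greenOp hL hρ hf hf]
  exact intervalIntegral.integral_nonneg (by linarith) fun x _ => mul_self_nonneg _

lemma weightedInner_self_nonneg (hL : 0 < L) (hpos : ∀ x ∈ Icc (-L) L, 0 < ρ x) :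
    0 ≤ weightedInner L ρ f f :=
  intervalIntegral.integral_nonneg (by linarith) fun x hx => by
    rw [mul_assoc]
    exact mul_nonneg (hpos x hx).le (mul_self_nonneg _)

lemma eqOn_zero_of_weightedInner_self_le (hL : 0 < L) (hρ : Continuous ρ)
    (hpos : ∀ x ∈ Icc (-L) L, 0 < ρ x) (hf : Continuous f)
    (h : weightedInner L ρ f f ≤ 0) : EqOn f 0 (Icc (-L) L) := by
  intro x hx
  by_contra hne
  refine h.not_gt (intervalIntegral.integral_pos (by linarith) (by fun_prop) ?_ ⟨x, hx, ?_⟩)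
  · intro y hy
    rw [mul_assoc]
    exact mul_nonneg (hpos y (Ioc_subset_Icc_self hy)).le (mul_self_nonneg _)
  · rw [mul_assoc]
    exact mul_pos (hpos x hx) (mul_self_pos.2 hne)

lemma weightedInner_sq_le (hL : 0 < L) (hρ : Continuous ρ)
    (hpos : ∀ x ∈ Icc (-L) L, 0 < ρ x) (hf : Continuous f) (hg : Continuous g) :
    weightedInner L ρ f g ^ 2 ≤ weightedInner L ρ f f * weightedInner L ρ g g := by
  have h := discrim_le_zero (a := weightedInner L ρ g g) (b := 2 * weightedInner L ρ f g)
    (c := weightedInner L ρ f f) fun x => by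
      have := weightedInner_self_nonneg (f := fun t => 1 * f t + x * g t) hL hpos
      rw [weightedInner_lin_self hρ hf hg] at this
      linarith
  rw [discrim] at h
  linarith

/-- A constant bounding the slope of `greenOp L ρ f` by the weighted norm of `f`. -/
noncomputable def slopeBound (L : ℝ) (ρ : ℝ → ℝ) : ℝ :=
  2 * √(weightedInner L ρ 1 1)

lemma slopeBound_nonneg : 0 ≤ slopeBound L ρ := by unfold slopeBound; positivity

lemma abs_weighted_primitive_le (hL : 0 < L) (hρ : Continuous ρ)
    (hpos : ∀ x ∈ Icc (-L) L, 0 < ρ x) (hf : Continuous f) {x : ℝ} (hx : x ∈ Icc (-L) L) :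
    |∫ z in (-L)..x, ρ z * f z| ≤ √(weightedInner L ρ 1 1) * √(weightedInner L ρ f f) := by
  have h1 : |∫ z in (-L)..x, ρ z * f z| ≤ weightedInner L ρ 1 (fun z => |f z|) := by
    calc |∫ z in (-L)..x, ρ z * f z| ≤ ∫ z in (-L)..x, |ρ z * f z| :=
          intervalIntegral.abs_integral_le_integral_abs hx.1
      _ ≤ ∫ z in (-L)..L, |ρ z * f z| :=
          intervalIntegral.integral_mono_interval le_rfl hx.1 hx.2
            (Eventually.of_forall fun z => abs_nonneg _)
            (Continuous.intervalIntegrable (by fun_prop) _ _)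
      _ = weightedInner L ρ 1 (fun z => |f z|) := by
          refine intervalIntegral.integral_congr fun z hz => ?_
          rw [uIcc_of_le (by linarith)] at hz
          simp [abs_mul, abs_of_pos (hpos z hz)]
  have h2 := weightedInner_sq_le (f := 1) (g := fun z => |f z|) hL hρ hpos continuous_one hf.abs
  have h3 : weightedInner L ρ (fun z => |f z|) (fun z => |f z|) = weightedInner L ρ f f := by
    simp only [weightedInner, mul_assoc, abs_mul_abs_self]
  rw [h3] at h2
  rw [← Real.sqrt_mul (weightedInner_self_nonneg hL hpos)]
  exact h1.trans (Real.le_sqrt_of_sq_le h2)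

lemma abs_greenSlope_le (hL : 0 < L) (hρ : Continuous ρ)
    (hpos : ∀ x ∈ Icc (-L) L, 0 < ρ x) (hf : Continuous f) {x : ℝ} (hx : x ∈ Icc (-L) L) :
    |greenSlope L ρ f x| ≤ slopeBound L ρ * √(weightedInner L ρ f f) := by
  have h1 : |initialSlope L ρ f| ≤ √(weightedInner L ρ 1 1) * √(weightedInner L ρ f f) := by
    have := intervalIntegral.norm_integral_le_of_norm_le_const (a := -L) (b := L)
      (f := fun u => ∫ z in (-L)..u, ρ z * f z)
      (C := √(weightedInner L ρ 1 1) * √(weightedInner L ρ f f)) fun u hu => by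
        rw [uIoc_of_le (by linarith)] at hu
        exact abs_weighted_primitive_le hL hρ hpos hf (Ioc_subset_Icc_self hu)
    rw [Real.norm_eq_abs, show L - -L = 2 * L by ring, abs_of_pos (by linarith : 0 < 2 * L)] at this
    rw [initialSlope, abs_mul, abs_of_pos (by positivity), one_div, inv_mul_le_iff₀ (by linarith)]
    linarith
  have h2 := abs_weighted_primitive_le hL hρ hpos hf hx
  have h3 := abs_sub (initialSlope L ρ f) (∫ z in (-L)..x, ρ z * f z)
  unfold greenSlope slopeBound
  linarith

lemma abs_greenOp_sub_le (hL : 0 < L) (hρ : Continuous ρ)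
    (hpos : ∀ x ∈ Icc (-L) L, 0 < ρ x) (hf : Continuous f) {x y : ℝ} (hx : x ∈ Icc (-L) L)
    (hy : y ∈ Icc (-L) L) :
    |greenOp L ρ f y - greenOp L ρ f x| ≤
      slopeBound L ρ * √(weightedInner L ρ f f) * |y - x| :=
  (convex_Icc (-L) L).norm_image_sub_le_of_norm_hasDerivWithin_le
    (fun x _ => (greenOp_hasDerivAt hρ hf x).hasDerivWithinAt)
    (fun _ hz => abs_greenSlope_le hL hρ hpos hf hz) hx hy

lemma abs_greenOp_le (hL : 0 < L) (hρ : Continuous ρ)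
    (hpos : ∀ x ∈ Icc (-L) L, 0 < ρ x) (hf : Continuous f) {x : ℝ} (hx : x ∈ Icc (-L) L) :
    |greenOp L ρ f x| ≤ slopeBound L ρ * (2 * L) * √(weightedInner L ρ f f) := by
  have h := abs_greenOp_sub_le hL hρ hpos hf (left_mem_Icc.2 (by linarith)) hx
  rw [greenOp_left, sub_zero, abs_of_nonneg (by linarith [hx.1] : 0 ≤ x - -L)] at h
  have h2 : slopeBound L ρ * √(weightedInner L ρ f f) * (x - -L) ≤
      slopeBound L ρ * √(weightedInner L ρ f f) * (2 * L) :=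
    mul_le_mul_of_nonneg_left (by linarith [hx.2]) (mul_nonneg slopeBound_nonneg (sqrt_nonneg _))
  linarith

/-- Solutions of `f = E · greenOp f` with vanishing initial slope vanish. -/
lemma eqOn_zero_of_initialSlope_eq_zero (hρ : Continuous ρ) (hf : Continuous f) {E : ℝ}
    (hE : ∀ x ∈ Icc (-L) L, f x = E * greenOp L ρ f x) (h0 : initialSlope L ρ f = 0) :
    EqOn f 0 (Icc (-L) L) := by
  obtain ⟨M, hM⟩ := isCompact_Icc.exists_bound_of_continuousOn
    (s := Icc (-L) L) hρ.continuousOn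
  have key := eq_zero_of_abs_deriv_le_mul_abs_self_of_eq_zero_right
    (f := fun x => (greenOp L ρ f x, greenSlope L ρ f x))
    (f' := fun x => (greenSlope L ρ f x, -(ρ x * f x))) (K := max 1 (|M| * |E|))
    (a := -L) (b := L)
    ((greenOp_continuous hρ hf).prodMk (greenSlope_continuous hρ hf)).continuousOn
    (fun x _ => ((greenOp_hasDerivAt hρ hf x).prodMk
      (greenSlope_hasDerivAt hρ hf x)).hasDerivWithinAt)
    (by simp [greenOp_left, greenSlope_left, h0])
    (fun x hx => by
      have hx' := Ico_subset_Icc_self hx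
      set N := ‖(greenOp L ρ f x, greenSlope L ρ f x)‖
      have hN : 0 ≤ N := norm_nonneg _
      have h1 : |greenOp L ρ f x| ≤ N := norm_fst_le (greenOp L ρ f x, greenSlope L ρ f x)
      have h2 : |greenSlope L ρ f x| ≤ N := norm_snd_le (greenOp L ρ f x, greenSlope L ρ f x)
      refine norm_prod_le_iff.2 ⟨?_, ?_⟩
      · exact h2.trans (le_mul_of_one_le_left hN (le_max_left _ _))
      · have h3 : |ρ x| ≤ |M| := (hM x hx').trans (le_abs_self M)
        simp only [norm_neg, norm_mul, Real.norm_eq_abs]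
        rw [hE x hx', abs_mul, ← mul_assoc]
        refine le_trans ?_ (mul_le_mul_of_nonneg_right (le_max_right _ _) hN)
        gcongr)
  intro x hx
  rw [hE x hx, (Prod.mk_eq_zero.1 (key x hx)).1]
  simp

/-- Eigenspaces are one-dimensional: two eigenfunctions for the same eigenvalue which are
orthogonal to each other cannot both be nonzero. -/
lemma eqOn_zero_of_orthogonal_eigenfunction (hL : 0 < L) (hρ : Continuous ρ)
    (hf : Continuous f) (hg : Continuous g) {E : ℝ}
    (hfE : ∀ x ∈ Icc (-L) L, f x = E * greenOp L ρ f x)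
    (hgE : ∀ x ∈ Icc (-L) L, g x = E * greenOp L ρ g x)
    (hgg : weightedInner L ρ g g = 1) (hfg : weightedInner L ρ f g = 0) :
    EqOn f 0 (Icc (-L) L) := by
  set a := initialSlope L ρ g with ha
  set b := initialSlope L ρ f with hb
  have hz : EqOn (fun x => a * f x + -b * g x) 0 (Icc (-L) L) := by
    refine eqOn_zero_of_initialSlope_eq_zero (E := E) hρ (by fun_prop) (fun x hx => ?_) ?_
    · rw [greenOp_lin hρ hf hg]
      linear_combination a * hfE x hx - b * hgE x hx
    · rw [initialSlope_lin hρ hf hg, ← ha, ← hb]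
      ring
  have hi : weightedInner L ρ (fun x => a * f x + -b * g x) g = weightedInner L ρ 0 g :=
    weightedInner_congr hL hz fun _ _ => rfl
  rw [weightedInner_lin hρ hf hg hg, hgg, hfg] at hi
  have hb0 : b = 0 := by simpa [weightedInner] using hi
  exact eqOn_zero_of_initialSlope_eq_zero hρ hf hfE hb0

end Green

/-- A uniformly bounded, uniformly Lipschitz sequence on a compact interval has a uniformly
convergent subsequence. -/
lemma exists_subseq_tendstoUniformlyOn {a b : ℝ} (hab : a ≤ b) {v : ℕ → ℝ → ℝ} {M K : ℝ}
    (hv : ∀ n, ∀ x ∈ Icc a b, |v n x| ≤ M)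
    (hK : ∀ n, ∀ x ∈ Icc a b, ∀ y ∈ Icc a b, |v n y - v n x| ≤ K * |y - x|) :
    ∃ g : ℝ → ℝ, Continuous g ∧ ∃ φ : ℕ → ℕ, StrictMono φ ∧
      TendstoUniformlyOn (fun n => v (φ n)) g atTop (Icc a b) := by
  have hlip : ∀ n, LipschitzWith K.toNNReal fun x : Icc a b => v n x := fun n =>
    LipschitzWith.of_dist_le_mul fun x y => by
      rw [Real.dist_eq, Subtype.dist_eq, Real.dist_eq]
      exact (hK n y y.2 x x.2).trans
        (mul_le_mul_of_nonneg_right (Real.le_coe_toNNReal K) (abs_nonneg _))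
  let V : ℕ → BoundedContinuousFunction (Icc a b) ℝ := fun n =>
    BoundedContinuousFunction.mkOfCompact ⟨fun x => v n x, (hlip n).continuous⟩
  have hcomp : IsCompact (closure (range V)) := by
    refine BoundedContinuousFunction.arzela_ascoli (Icc (-M) M) isCompact_Icc _ ?_ ?_
    · rintro _ x ⟨n, rfl⟩
      exact abs_le.1 (hv n x x.2)
    · refine (LipschitzWith.uniformEquicontinuous _ K.toNNReal ?_).equicontinuous
      rintro ⟨_, n, rfl⟩
      exact hlip n
  obtain ⟨G, -, φ, hφ, hG⟩ := hcomp.tendsto_subseq fun n => subset_closure (mem_range_self n)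
  refine ⟨IccExtend hab G, G.continuous.Icc_extend', φ, hφ, ?_⟩
  rw [BoundedContinuousFunction.tendsto_iff_tendstoUniformly,
    Metric.tendstoUniformly_iff] at hG
  rw [Metric.tendstoUniformlyOn_iff]
  intro ε hε
  filter_upwards [hG ε hε] with n hn x hx
  rw [IccExtend_of_mem hab G hx]
  exact hn ⟨x, hx⟩

section Limit

variable {L : ℝ} {ρ : ℝ → ℝ} {v : ℕ → ℝ → ℝ} {g : ℝ → ℝ}

lemma weightedInner_mul_le_of_abs_le (hL : 0 < L) (hρ : Continuous ρ)
    (hpos : ∀ x ∈ Icc (-L) L, 0 < ρ x) {f : ℝ → ℝ} (hf : Continuous f) {ε : ℝ}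
    (h : ∀ x ∈ Icc (-L) L, |f x| ≤ ε) :
    weightedInner L ρ f f ≤ ε ^ 2 * weightedInner L ρ 1 1 := by
  simp only [weightedInner]
  rw [← intervalIntegral.integral_const_mul]
  refine intervalIntegral.integral_mono_on (by linarith)
    (Continuous.intervalIntegrable (by fun_prop) _ _)
    (Continuous.intervalIntegrable (by fun_prop) _ _) fun x hx => ?_
  have h1 : f x ^ 2 ≤ ε ^ 2 := sq_le_sq' (abs_le.1 (h x hx)).1 (abs_le.1 (h x hx)).2
  have := mul_le_mul_of_nonneg_left h1 (hpos x hx).le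
  simp only [Pi.one_apply]
  linarith

/-- Uniform convergence implies convergence of the weighted norm of the difference. -/
lemma tendsto_weightedInner_sub (hL : 0 < L) (hρ : Continuous ρ)
    (hpos : ∀ x ∈ Icc (-L) L, 0 < ρ x) (hv : ∀ n, Continuous (v n)) (hg : Continuous g)
    (h : TendstoUniformlyOn v g atTop (Icc (-L) L)) :
    Tendsto (fun n => weightedInner L ρ (fun x => 1 * v n x + (-1) * g x)
      (fun x => 1 * v n x + (-1) * g x)) atTop (𝓝 0) := by
  have hW := weightedInner_self_nonneg (f := 1) hL hpos
  rw [Metric.tendsto_atTop']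
  intro ε hε
  obtain ⟨δ, hδ, hδε⟩ : ∃ δ > 0, δ ^ 2 * weightedInner L ρ 1 1 < ε := by
    have : Tendsto (fun δ : ℝ => δ ^ 2 * weightedInner L ρ 1 1) (𝓝[>] 0) (𝓝 0) := by
      have hc : Continuous fun δ : ℝ => δ ^ 2 * weightedInner L ρ 1 1 := by fun_prop
      simpa using (hc.tendsto 0).mono_left nhdsWithin_le_nhds
    obtain ⟨δ, h1, h2⟩ := ((this.eventually_lt_const hε).and self_mem_nhdsWithin).exists
    exact ⟨δ, h2, h1⟩
  obtain ⟨N, hN⟩ := eventually_atTop.1 (Metric.tendstoUniformlyOn_iff.1 h δ hδ)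
  refine ⟨N, fun n hn => ?_⟩
  have hvn := hv n
  rw [Real.dist_eq, sub_zero, abs_of_nonneg (weightedInner_self_nonneg hL hpos)]
  refine lt_of_le_of_lt (weightedInner_mul_le_of_abs_le hL hρ hpos (by fun_prop)
    fun x hx => ?_) hδε
  have := hN n hn.le x hx
  rw [dist_comm, Real.dist_eq] at this
  rw [one_mul, neg_one_mul, ← sub_eq_add_neg]
  exact this.le

lemma tendsto_weightedInner_left (hL : 0 < L) (hρ : Continuous ρ)
    (hpos : ∀ x ∈ Icc (-L) L, 0 < ρ x) (hv : ∀ n, Continuous (v n)) (hg : Continuous g)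
    (h : TendstoUniformlyOn v g atTop (Icc (-L) L)) {k : ℝ → ℝ} (hk : Continuous k) :
    Tendsto (fun n => weightedInner L ρ (v n) k) atTop (𝓝 (weightedInner L ρ g k)) := by
  have h0 := tendsto_weightedInner_sub hL hρ hpos hv hg h
  have h1 : Tendsto (fun n => weightedInner L ρ (fun x => 1 * v n x + (-1) * g x) k)
      atTop (𝓝 0) := by
    refine squeeze_zero_norm (a := fun n => √(weightedInner L ρ
      (fun x => 1 * v n x + (-1) * g x) (fun x => 1 * v n x + (-1) * g x) *
        weightedInner L ρ k k)) (fun n => ?_) ?_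
    · have hvn := hv n
      exact Real.abs_le_sqrt (weightedInner_sq_le hL hρ hpos (by fun_prop) hk)
    · simpa using (h0.mul_const (weightedInner L ρ k k)).sqrt
  have h2 := h1.add_const (weightedInner L ρ g k)
  rw [zero_add] at h2
  refine h2.congr fun n => ?_
  rw [weightedInner_lin hρ (hv n) hg hk]
  ring

lemma tendsto_weightedInner_self (hL : 0 < L) (hρ : Continuous ρ)
    (hpos : ∀ x ∈ Icc (-L) L, 0 < ρ x) (hv : ∀ n, Continuous (v n)) (hg : Continuous g)
    (h : TendstoUniformlyOn v g atTop (Icc (-L) L)) :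
    Tendsto (fun n => weightedInner L ρ (v n) (v n)) atTop (𝓝 (weightedInner L ρ g g)) := by
  have h0 := tendsto_weightedInner_sub hL hρ hpos hv hg h
  have h1 := tendsto_weightedInner_left hL hρ hpos hv hg h hg
  have h2 := (h0.add (h1.const_mul 2)).sub_const (weightedInner L ρ g g)
  rw [show 0 + 2 * weightedInner L ρ g g - weightedInner L ρ g g = weightedInner L ρ g g by
    ring] at h2
  refine h2.congr fun n => ?_
  rw [weightedInner_lin_self hρ (hv n) hg]
  ring

lemma tendstoUniformlyOn_greenOp (hL : 0 < L) (hρ : Continuous ρ)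
    (hpos : ∀ x ∈ Icc (-L) L, 0 < ρ x) (hv : ∀ n, Continuous (v n)) (hg : Continuous g)
    (h : TendstoUniformlyOn v g atTop (Icc (-L) L)) :
    TendstoUniformlyOn (fun n => greenOp L ρ (v n)) (greenOp L ρ g) atTop (Icc (-L) L) := by
  have h0 := ((tendsto_weightedInner_sub hL hρ hpos hv hg h).sqrt).const_mul
    (slopeBound L ρ * (2 * L))
  rw [Real.sqrt_zero, mul_zero] at h0
  rw [Metric.tendstoUniformlyOn_iff]
  intro ε hε
  filter_upwards [h0.eventually_lt_const hε] with n hn x hx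
  have hvn := hv n
  have := abs_greenOp_le (f := fun x => 1 * v n x + (-1) * g x) hL hρ hpos (by fun_prop) hx
  rw [greenOp_lin hρ hvn hg, one_mul, neg_one_mul, ← sub_eq_add_neg] at this
  rw [dist_comm, Real.dist_eq]
  exact this.trans_lt hn

end Limit

/-- For a log-convex sequence of positive reals whose successive ratios are bounded, these ratios
increase to a limit. -/
lemma exists_ratio_limit {a : ℕ → ℝ} (hpos : ∀ n, 0 < a n) {C : ℝ}
    (hC : ∀ n, a (n + 1) ≤ C * a n) (hlc : ∀ n, a (n + 1) ^ 2 ≤ a n * a (n + 2)) :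
    ∃ R, 0 < R ∧ (∀ n, a (n + 1) ≤ R * a n) ∧
      Tendsto (fun n => a (n + 1) / a n) atTop (𝓝 R) := by
  have hmono : Monotone fun n => a (n + 1) / a n := monotone_nat_of_le_succ fun n => by
    rw [div_le_div_iff₀ (hpos n) (hpos (n + 1))]
    linarith [hlc n]
  have hbdd : BddAbove (range fun n => a (n + 1) / a n) :=
    ⟨C, by rintro _ ⟨n, rfl⟩; exact (div_le_iff₀ (hpos n)).2 (hC n)⟩
  have hle := le_ciSup hbdd
  exact ⟨_, (div_pos (hpos 1) (hpos 0)).trans_le (hle 0),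
    fun n => (div_le_iff₀ (hpos n)).1 (hle n), tendsto_atTop_ciSup hmono hbdd⟩

section Iterates

variable {L : ℝ} {ρ w : ℝ → ℝ}

lemma iterate_greenOp_continuous (hρ : Continuous ρ) (hw : Continuous w) (n : ℕ) :
    Continuous ((greenOp L ρ)^[n] w) := by
  induction n with
  | zero => exact hw
  | succ n ih => rw [Function.iterate_succ_apply']; exact greenOp_continuous hρ ih

lemma weightedInner_greenOp_self_le (hL : 0 < L) (hρ : Continuous ρ)
    (hpos : ∀ x ∈ Icc (-L) L, 0 < ρ x) (hw : Continuous w) :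
    weightedInner L ρ (greenOp L ρ w) (greenOp L ρ w) ≤
      (slopeBound L ρ * (2 * L)) ^ 2 * weightedInner L ρ 1 1 * weightedInner L ρ w w := by
  have h := weightedInner_mul_le_of_abs_le hL hρ hpos (greenOp_continuous (L := L) hρ hw)
    fun x hx => abs_greenOp_le hL hρ hpos hw hx
  rw [mul_pow, Real.sq_sqrt (weightedInner_self_nonneg hL hpos)] at h
  linarith

/-- If no iterate of `w` under `greenOp` vanishes, the weighted norms of the iterates grow at most
like `r ^ n` for some eigenvalue `r > 0`; there is an eigenfunction `r g + greenOp g` whose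
component `g` is orthogonal to everything that is orthogonal to all iterates of `w`. -/
lemma exists_eigenfunction_of_iterates (hL : 0 < L) (hρ : Continuous ρ)
    (hpos : ∀ x ∈ Icc (-L) L, 0 < ρ x) (hw : Continuous w)
    (hne : ∀ n, 0 < weightedInner L ρ ((greenOp L ρ)^[n] w) ((greenOp L ρ)^[n] w))
    {k : ℝ → ℝ} (hk : Continuous k)
    (hwk : ∀ n, weightedInner L ρ ((greenOp L ρ)^[n] w) k = 0) :
    ∃ r > 0, (∀ n, weightedInner L ρ ((greenOp L ρ)^[n + 1] w) ((greenOp L ρ)^[n + 1] w) ≤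
        r ^ 2 * weightedInner L ρ ((greenOp L ρ)^[n] w) ((greenOp L ρ)^[n] w)) ∧
      ∃ h : ℝ → ℝ, Continuous h ∧ (∃ x ∈ Icc (-L) L, h x ≠ 0) ∧
        (∀ x ∈ Icc (-L) L, greenOp L ρ h x = r * h x) ∧
        ∃ g : ℝ → ℝ, Continuous g ∧ weightedInner L ρ g k = 0 ∧
          ∀ x, h x = r * g x + 1 * greenOp L ρ g x := by
  set W : ℕ → ℝ → ℝ := fun n => (greenOp L ρ)^[n] w with hWdef
  have hW : ∀ n, Continuous (W n) := iterate_greenOp_continuous hρ hw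
  have hWs : ∀ n, greenOp L ρ (W n) = W (n + 1) := fun n =>
    (Function.iterate_succ_apply' (greenOp L ρ) n w).symm
  set a : ℕ → ℝ := fun n => weightedInner L ρ (W n) (W n) with ha
  obtain ⟨R, hR, hle, hlim⟩ := exists_ratio_limit (a := a) hne
    (fun n => by
      have := weightedInner_greenOp_self_le hL hρ hpos (hW n)
      rwa [hWs] at this)
    (fun n => by
      have h1 := weightedInner_greenOp_symm hL hρ (hW n) (hW (n + 1))
      rw [hWs, hWs] at h1
      simp only [ha]
      rw [h1]
      exact weightedInner_sq_le hL hρ hpos (hW n) (hW (n + 2)))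
  set r := √R with hr
  have hr0 : 0 < r := Real.sqrt_pos.2 hR
  have hrR : r ^ 2 = R := Real.sq_sqrt hR.le
  refine ⟨r, hr0, fun n => by rw [hrR]; exact hle n, ?_⟩
  have hsq : ∀ n, √(a n) ^ 2 = a n := fun n => Real.sq_sqrt (hne n).le
  -- the normalized iterates
  have hUlin : ∀ (c : ℝ) (f : ℝ → ℝ), Continuous f →
      greenOp L ρ (fun x => c * f x) = fun x => c * greenOp L ρ f x := fun c f hf => by
    funext x
    have := greenOp_lin (L := L) hρ hf hf c 0 x
    simpa using this
  have hIlin : ∀ (c : ℝ) (f : ℝ → ℝ), Continuous f →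
      weightedInner L ρ (fun x => c * f x) (fun x => c * f x) =
        c ^ 2 * weightedInner L ρ f f := fun c f hf => by
    have := weightedInner_lin_self (L := L) hρ hf hf c 0
    simpa using this
  have hAU : ∀ j n, greenOp L ρ (fun x => (√(a n))⁻¹ * W (n + j) x) =
      fun x => (√(a n))⁻¹ * W (n + j + 1) x := fun j n => by
    rw [hUlin _ _ (hW _), hWs]
  have hnorm : ∀ j n, weightedInner L ρ (fun x => (√(a n))⁻¹ * W (n + j) x)
      (fun x => (√(a n))⁻¹ * W (n + j) x) = a (n + j) / a n := fun j n => by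
    rw [hIlin _ _ (hW _), inv_pow, hsq, div_eq_inv_mul]
  have hlim2 : Tendsto (fun n => a (n + 2) / a n) atTop (𝓝 (R * R)) :=
    ((hlim.comp (tendsto_add_atTop_nat 1)).mul hlim).congr fun n => by
      simp only [Function.comp]
      rw [div_mul_div_cancel₀ (hne (n + 1)).ne']
  have hlim3 : Tendsto (fun n => a (n + 3) / a n) atTop (𝓝 (R * (R * R))) :=
    ((hlim.comp (tendsto_add_atTop_nat 2)).mul hlim2).congr fun n => by
      simp only [Function.comp]
      rw [div_mul_div_cancel₀ (hne (n + 2)).ne']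
  have hcv : ∀ j n, Continuous fun x => (√(a n))⁻¹ * W (n + j) x := fun j n =>
    (hW _).const_mul _
  have hone : ∀ n, √(weightedInner L ρ (fun x => (√(a n))⁻¹ * W (n + 0) x)
      (fun x => (√(a n))⁻¹ * W (n + 0) x)) = 1 := fun n => by
    rw [hnorm, add_zero, div_self (hne n).ne', Real.sqrt_one]
  obtain ⟨g, hg, φ, hφ, hconv⟩ := exists_subseq_tendstoUniformlyOn (a := -L) (b := L)
    (by linarith) (v := fun n x => (√(a n))⁻¹ * W (n + 1) x)
    (M := slopeBound L ρ * (2 * L)) (K := slopeBound L ρ)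
    (fun n x hx => by
      have := abs_greenOp_le hL hρ hpos (hcv 0 n) hx
      rwa [hAU, hone, mul_one] at this)
    (fun n x hx y hy => by
      have := abs_greenOp_sub_le hL hρ hpos (hcv 0 n) hx hy
      rwa [hAU, hone, mul_one] at this)
  have hφt := hφ.tendsto_atTop
  have hAg := greenOp_continuous (L := L) hρ hg
  have hAAg := greenOp_continuous (L := L) hρ hAg
  have hconv2 := tendstoUniformlyOn_greenOp hL hρ hpos (fun n => hcv 1 (φ n)) hg hconv
  simp only [hAU] at hconv2
  have hconv3 := tendstoUniformlyOn_greenOp hL hρ hpos (fun n => hcv 2 (φ n)) hAg hconv2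
  simp only [hAU 2] at hconv3
  have hn1 : weightedInner L ρ g g = R := by
    refine tendsto_nhds_unique
      (tendsto_weightedInner_self hL hρ hpos (fun n => hcv 1 (φ n)) hg hconv) ?_
    simp only [hnorm]
    exact hlim.comp hφt
  have hn2 : weightedInner L ρ (greenOp L ρ g) (greenOp L ρ g) = R * R := by
    refine tendsto_nhds_unique
      (tendsto_weightedInner_self hL hρ hpos (fun n => hcv 2 (φ n)) hAg hconv2) ?_
    simp only [hnorm 2]
    exact hlim2.comp hφt
  have hn3 : weightedInner L ρ (greenOp L ρ (greenOp L ρ g))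
      (greenOp L ρ (greenOp L ρ g)) = R * (R * R) := by
    refine tendsto_nhds_unique
      (tendsto_weightedInner_self hL hρ hpos (fun n => hcv 3 (φ n)) hAAg hconv3) ?_
    simp only [hnorm 3]
    exact hlim3.comp hφt
  have hgk : weightedInner L ρ g k = 0 := by
    refine tendsto_nhds_unique
      (tendsto_weightedInner_left hL hρ hpos (fun n => hcv 1 (φ n)) hg hconv hk) ?_
    refine tendsto_const_nhds.congr fun n => ?_
    have := weightedInner_lin (L := L) hρ (hW (φ n + 1)) (hW (φ n + 1)) hk (√(a (φ n)))⁻¹ 0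
    simp only [zero_mul, add_zero] at this
    rw [this, hwk, mul_zero]
  have hsymm := weightedInner_greenOp_symm hL hρ hAg hg
  have hzero : EqOn (fun x => 1 * greenOp L ρ (greenOp L ρ g) x + -R * g x) 0
      (Icc (-L) L) := by
    refine eqOn_zero_of_weightedInner_self_le hL hρ hpos (by fun_prop) ?_
    rw [weightedInner_lin_self hρ hAAg hg, hsymm, hn1, hn2, hn3]
    nlinarith
  refine ⟨fun x => r * g x + 1 * greenOp L ρ g x, by fun_prop, ?_, fun x hx => ?_,
    g, hg, hgk, fun x => rfl⟩
  · by_contra! hcon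
    have h0 : weightedInner L ρ (fun x => r * g x + 1 * greenOp L ρ g x)
        (fun x => r * g x + 1 * greenOp L ρ g x) = weightedInner L ρ 0 0 :=
      weightedInner_congr hL hcon hcon
    rw [weightedInner_lin_self hρ hg hAg, hn1, hn2, weightedInner_comm] at h0
    have h1 := weightedInner_greenOp_self_nonneg hL hρ hg
    have h2 : weightedInner L ρ 0 0 = 0 := by simp [weightedInner]
    rw [h2] at h0
    have h3 : 0 ≤ 2 * r * 1 * weightedInner L ρ (greenOp L ρ g) g := by positivity
    have h4 : 0 < r ^ 2 * R := by positivity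
    nlinarith
  · rw [greenOp_lin hρ hg hAg]
    have := hzero hx
    simp only [Pi.zero_apply, ← hrR] at this
    linear_combination this

end Iterates

section Fundamental

variable {L E₀ : ℝ} {ρ Ψ : ℝ → ℝ}

lemma eq_left_of_hasDerivWithinAt_zero {a b : ℝ} {f : ℝ → ℝ}
    (h : ∀ x ∈ Icc a b, HasDerivWithinAt f 0 (Icc a b) x) {x : ℝ} (hx : x ∈ Icc a b) :
    f x = f a := by
  have := (convex_Icc a b).norm_image_sub_le_of_norm_hasDerivWithin_le (C := 0) h
    (by simp) (left_mem_Icc.2 (hx.1.trans hx.2)) hx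
  rwa [zero_mul, norm_le_zero_iff, sub_eq_zero] at this

/-- A classical Dirichlet eigenfunction satisfies the integral equation `ψ = E · greenOp ψ`. -/
lemma eq_mul_greenOp_of_eigenfunction (hL : 0 < L) (hρ : Continuous ρ) {E : ℝ} {ψ : ℝ → ℝ}
    (hψ : ContDiffOn ℝ 2 ψ (Icc (-L) L))
    (hψeq : ∀ x ∈ Icc (-L) L,
      -(iteratedDerivWithin 2 ψ (Icc (-L) L) x) = E * (ρ x * ψ x))
    (hψa : ψ (-L) = 0) (hψb : ψ L = 0) (hΨ : Continuous Ψ) (hΨψ : EqOn Ψ ψ (Icc (-L) L)) :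
    ∀ x ∈ Icc (-L) L, Ψ x = E * greenOp L ρ Ψ x := by
  set I := Icc (-L) L with hI
  have hu : UniqueDiffOn ℝ I := uniqueDiffOn_Icc (by linarith)
  have hd0 : ∀ x ∈ I, HasDerivWithinAt ψ (derivWithin ψ I x) I x := fun x hx =>
    ((hψ.differentiableOn (by norm_num)) x hx).hasDerivWithinAt
  have hd1 : ∀ x ∈ I, HasDerivWithinAt (derivWithin ψ I) (-(E * (ρ x * Ψ x))) I x :=
    fun x hx => by
      have h1 : ContDiffOn ℝ 1 (derivWithin ψ I) I := hψ.derivWithin hu (by norm_num)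
      have h2 := ((h1.differentiableOn (by norm_num)) x hx).hasDerivWithinAt
      have h3 := hψeq x hx
      rw [iteratedDerivWithin_succ, iteratedDerivWithin_one] at h3
      rwa [hΨψ hx, ← h3, neg_neg]
  have hc : ∀ x ∈ I, derivWithin ψ I x - E * greenSlope L ρ Ψ x =
      derivWithin ψ I (-L) - E * greenSlope L ρ Ψ (-L) := fun x hx => by
    refine eq_left_of_hasDerivWithinAt_zero
      (f := fun x => derivWithin ψ I x - E * greenSlope L ρ Ψ x) (fun y hy => ?_) hx
    exact ((hd1 y hy).fun_sub
      ((greenSlope_hasDerivAt hρ hΨ y).hasDerivWithinAt.const_mul E)).congr_deriv (by ring)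
  set c := derivWithin ψ I (-L) - E * greenSlope L ρ Ψ (-L)
  have hlin : ∀ x ∈ I, ψ x - E * greenOp L ρ Ψ x - c * x =
      ψ (-L) - E * greenOp L ρ Ψ (-L) - c * -L := fun x hx => by
    refine eq_left_of_hasDerivWithinAt_zero
      (f := fun x => ψ x - E * greenOp L ρ Ψ x - c * x) (fun y hy => ?_) hx
    exact (((hd0 y hy).fun_sub
      ((greenOp_hasDerivAt hρ hΨ y).hasDerivWithinAt.const_mul E)).fun_sub
        ((hasDerivWithinAt_id y I).const_mul c)).congr_deriv (by linear_combination hc y hy)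
  have hc0 : c = 0 := by
    have := hlin L (right_mem_Icc.2 (by linarith))
    rw [greenOp_right hL hρ hΨ, greenOp_left, hψa, hψb] at this
    have h2 : c * L = 0 := by linarith
    exact (mul_eq_zero.1 h2).resolve_right hL.ne'
  intro x hx
  have := hlin x hx
  rw [greenOp_left, hψa, hc0] at this
  rw [hΨψ hx]
  linarith

/-- An eigenfunction of `greenOp` gives rise to a classical Dirichlet eigenpair. -/
lemma exists_eigenpair_of_greenOp_eq (hL : 0 < L) (hρ : Continuous ρ) {h : ℝ → ℝ} {r : ℝ}
    (hr : r ≠ 0) (hh : Continuous h) (hne : ∃ x ∈ Icc (-L) L, h x ≠ 0)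
    (heq : ∀ x ∈ Icc (-L) L, greenOp L ρ h x = r * h x) :
    ∃ ψ : ℝ → ℝ, ContDiffOn ℝ 2 ψ (Icc (-L) L) ∧ (∃ x ∈ Icc (-L) L, ψ x ≠ 0) ∧
      (∀ x ∈ Icc (-L) L,
        -(iteratedDerivWithin 2 ψ (Icc (-L) L) x) = r⁻¹ * (ρ x * ψ x)) ∧
      ψ (-L) = 0 ∧ ψ L = 0 := by
  have hd1 : deriv (greenOp L ρ h) = greenSlope L ρ h :=
    funext fun x => (greenOp_hasDerivAt hρ hh x).deriv
  have hd2 : deriv (greenSlope L ρ h) = fun x => -(ρ x * h x) :=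
    funext fun x => (greenSlope_hasDerivAt hρ hh x).deriv
  have hC1 : ContDiff ℝ 1 (greenSlope L ρ h) := by
    refine contDiff_one_iff_deriv.2
      ⟨fun x => (greenSlope_hasDerivAt hρ hh x).differentiableAt, ?_⟩
    rw [hd2]
    fun_prop
  have hC2 : ContDiff ℝ 2 (greenOp L ρ h) := by
    refine (contDiff_succ_iff_deriv (n := 1)).2
      ⟨fun x => (greenOp_hasDerivAt hρ hh x).differentiableAt, by simp, ?_⟩
    rwa [hd1]
  refine ⟨greenOp L ρ h, hC2.contDiffOn, ?_, fun x hx => ?_, greenOp_left,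
    greenOp_right hL hρ hh⟩
  · obtain ⟨x, hx, hxne⟩ := hne
    exact ⟨x, hx, by rw [heq x hx]; exact mul_ne_zero hr hxne⟩
  · rw [iteratedDerivWithin_eq_iteratedDeriv (uniqueDiffOn_Icc (by linarith))
      hC2.contDiffAt hx, iteratedDeriv_succ, iteratedDeriv_one, hd1, hd2, heq x hx]
    field_simp

lemma weightedInner_greenOp_eigenfunction (hL : 0 < L) (hρ : Continuous ρ) (hE₀ : 0 < E₀)
    (hΨ : Continuous Ψ) (hΨeq : ∀ x ∈ Icc (-L) L, Ψ x = E₀ * greenOp L ρ Ψ x)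
    {g : ℝ → ℝ} (hg : Continuous g) (h0 : weightedInner L ρ g Ψ = 0) :
    weightedInner L ρ (greenOp L ρ g) Ψ = 0 := by
  have hA := greenOp_continuous (L := L) hρ hΨ
  have h1 : weightedInner L ρ Ψ g =
      weightedInner L ρ (fun x => E₀ * greenOp L ρ Ψ x + 0 * greenOp L ρ Ψ x) g :=
    weightedInner_congr hL (fun x hx => by rw [hΨeq x hx]; ring) fun _ _ => rfl
  rw [weightedInner_lin hρ hA hA hg, weightedInner_comm, h0, zero_mul, add_zero] at h1
  rw [weightedInner_greenOp_symm hL hρ hg hΨ, weightedInner_comm]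
  exact (mul_eq_zero.1 h1.symm).resolve_left hE₀.ne'

lemma iterate_weightedInner_eq_zero (hL : 0 < L) (hρ : Continuous ρ) (hE₀ : 0 < E₀)
    (hΨ : Continuous Ψ) (hΨeq : ∀ x ∈ Icc (-L) L, Ψ x = E₀ * greenOp L ρ Ψ x)
    {w : ℝ → ℝ} (hw : Continuous w) (h0 : weightedInner L ρ w Ψ = 0) (n : ℕ) :
    weightedInner L ρ ((greenOp L ρ)^[n] w) Ψ = 0 := by
  induction n with
  | zero => exact h0
  | succ n ih =>
    rw [Function.iterate_succ_apply']
    exact weightedInner_greenOp_eigenfunction hL hρ hE₀ hΨ hΨeq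
      (iterate_greenOp_continuous hρ hw n) ih

/-- On the orthogonal complement of the fundamental mode, the iterates of `greenOp` decay faster
than `E₀⁻¹ ^ n` in the weighted norm. -/
lemma tendsto_iterate_weightedInner (hL : 0 < L) (hρ : Continuous ρ)
    (hpos : ∀ x ∈ Icc (-L) L, 0 < ρ x) (hE₀ : 0 < E₀) (hΨ : Continuous Ψ)
    (hΨeq : ∀ x ∈ Icc (-L) L, Ψ x = E₀ * greenOp L ρ Ψ x)
    (hΨΨ : weightedInner L ρ Ψ Ψ = 1)
    (hgap : ∀ (r : ℝ) (h : ℝ → ℝ), 0 < r → Continuous h → (∃ x ∈ Icc (-L) L, h x ≠ 0) →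
      (∀ x ∈ Icc (-L) L, greenOp L ρ h x = r * h x) → r⁻¹ ≠ E₀ → E₀ < r⁻¹)
    {w : ℝ → ℝ} (hw : Continuous w) (h0 : weightedInner L ρ w Ψ = 0) :
    Tendsto (fun n => (E₀ ^ n) ^ 2 *
      weightedInner L ρ ((greenOp L ρ)^[n] w) ((greenOp L ρ)^[n] w)) atTop (𝓝 0) := by
  have hW := iterate_greenOp_continuous (L := L) hρ hw
  by_cases hne : ∀ n, 0 < weightedInner L ρ ((greenOp L ρ)^[n] w) ((greenOp L ρ)^[n] w)
  · obtain ⟨r, hr, hle, h, hh, hhne, hheq, g, hg, hgΨ, hhg⟩ :=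
      exists_eigenfunction_of_iterates hL hρ hpos hw hne hΨ
        (iterate_weightedInner_eq_zero hL hρ hE₀ hΨ hΨeq hw h0)
    have hrE : r⁻¹ ≠ E₀ := by
      intro hr0
      obtain ⟨x, hx, hxne⟩ := hhne
      refine hxne (eqOn_zero_of_orthogonal_eigenfunction hL hρ hh hΨ (E := E₀) ?_ hΨeq hΨΨ ?_ hx)
      · intro y hy
        rw [hheq y hy, ← hr0, inv_mul_cancel_left₀ hr.ne']
      · rw [funext hhg, weightedInner_lin hρ hg (greenOp_continuous hρ hg) hΨ, hgΨ,
          weightedInner_greenOp_eigenfunction hL hρ hE₀ hΨ hΨeq hg hgΨ]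
        ring
    have hlt : E₀ * r < 1 := by
      have := hgap r h hr hh hhne hheq hrE
      rwa [lt_inv_comm₀ hE₀ hr, lt_inv_comm₀ hr hE₀, ← one_div, lt_div_iff₀ hr] at this
    have hq0 : 0 ≤ (E₀ * r) ^ 2 := by positivity
    have hq1 : (E₀ * r) ^ 2 < 1 := pow_lt_one₀ (by positivity) hlt two_ne_zero
    refine squeeze_zero (g := fun n => ((E₀ * r) ^ 2) ^ n * weightedInner L ρ w w)
      (fun n => mul_nonneg (sq_nonneg _) (hne n).le) (fun n => ?_)
      (by simpa using (tendsto_pow_atTop_nhds_zero_of_lt_one hq0 hq1).mul_const _)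
    induction n with
    | zero => simp
    | succ n ih =>
      calc _ ≤ (E₀ ^ (n + 1)) ^ 2 * (r ^ 2 *
            weightedInner L ρ ((greenOp L ρ)^[n] w) ((greenOp L ρ)^[n] w)) :=
            mul_le_mul_of_nonneg_left (hle n) (sq_nonneg _)
        _ = (E₀ * r) ^ 2 * ((E₀ ^ n) ^ 2 *
            weightedInner L ρ ((greenOp L ρ)^[n] w) ((greenOp L ρ)^[n] w)) := by ring
        _ ≤ (E₀ * r) ^ 2 * (((E₀ * r) ^ 2) ^ n * weightedInner L ρ w w) :=
            mul_le_mul_of_nonneg_left ih hq0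
        _ = _ := by ring
  · push Not at hne
    obtain ⟨N, hN⟩ := hne
    have hz : ∀ n, N ≤ n →
        weightedInner L ρ ((greenOp L ρ)^[n] w) ((greenOp L ρ)^[n] w) ≤ 0 := fun n hn => by
      induction n, hn using Nat.le_induction with
      | base => exact hN
      | succ n _ ih =>
        rw [Function.iterate_succ_apply']
        exact (weightedInner_greenOp_self_le hL hρ hpos (hW n)).trans
          (mul_nonpos_of_nonneg_of_nonpos
            (mul_nonneg (sq_nonneg _) (weightedInner_self_nonneg hL hpos)) ih)
    refine tendsto_const_nhds.congr' ?_
    filter_upwards [eventually_ge_atTop N] with n hn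
    rw [le_antisymm (hz n hn) (weightedInner_self_nonneg hL hpos), mul_zero]

lemma iterate_greenOp_decomposition (hL : 0 < L) (hρ : Continuous ρ) (hE₀ : 0 < E₀)
    (hΨ : Continuous Ψ) (hΨeq : ∀ x ∈ Icc (-L) L, Ψ x = E₀ * greenOp L ρ Ψ x)
    {f w : ℝ → ℝ} (hw : Continuous w) {c : ℝ} (hf : ∀ x, f x = c * Ψ x + 1 * w x) (n : ℕ) :
    ∀ x ∈ Icc (-L) L, (greenOp L ρ)^[n] f x =
      (c * (E₀ ^ n)⁻¹) * Ψ x + 1 * (greenOp L ρ)^[n] w x := by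
  induction n with
  | zero => simp [hf]
  | succ n ih =>
    intro x hx
    rw [Function.iterate_succ_apply', Function.iterate_succ_apply',
      greenOp_congr hL (fun z hz => by rw [ih z hz]) hx,
      greenOp_lin hρ hΨ (iterate_greenOp_continuous hρ hw n), hΨeq x hx]
    field_simp
    ring

end Fundamental


/-- Theorem 1 of the paper: if `(E₀, Ψ₀)` is a fundamental Dirichlet eigenpair of the
inhomogeneous string (every other Dirichlet eigenvalue is larger than `E₀`), and `ξ₀`
is a continuous function with nonzero overlap `∫ √ρ Ψ₀ ξ₀ ≠ 0`, then the normalized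
iterates `c_n ξ_n/√ρ` of the iteration map converge uniformly on `[-L, L]`, up to an
overall sign, to the fundamental mode `Ψ₀`. -/
theorem stringIter_converges_to_fundamental_mode
    (L : ℝ) (hL : 0 < L) (ρ : ℝ → ℝ)
    (hρ : Continuous ρ) (hρpos : ∀ x ∈ Set.Icc (-L) L, 0 < ρ x)
    (E₀ : ℝ) (Ψ₀ : ℝ → ℝ)
    (hΨ : ContDiffOn ℝ 2 Ψ₀ (Set.Icc (-L) L))
    (hΨne : ∃ x ∈ Set.Icc (-L) L, Ψ₀ x ≠ 0)
    (hΨeq : ∀ x ∈ Set.Icc (-L) L,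
      -(iteratedDerivWithin 2 Ψ₀ (Set.Icc (-L) L) x) = E₀ * (ρ x * Ψ₀ x))
    (hΨa : Ψ₀ (-L) = 0) (hΨb : Ψ₀ L = 0)
    (hΨnorm : ∫ x in (-L)..L, ρ x * Ψ₀ x ^ 2 = 1)
    (hfund : ∀ (E : ℝ) (ψ : ℝ → ℝ), ContDiffOn ℝ 2 ψ (Set.Icc (-L) L) →
      (∃ x ∈ Set.Icc (-L) L, ψ x ≠ 0) →
      (∀ x ∈ Set.Icc (-L) L,
        -(iteratedDerivWithin 2 ψ (Set.Icc (-L) L) x) = E * (ρ x * ψ x)) →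
      ψ (-L) = 0 → ψ L = 0 → E ≠ E₀ → E₀ < E)
    (ξ : ℕ → ℝ → ℝ) (ξ₀ : ℝ → ℝ)
    (hξ₀cont : ContinuousOn ξ₀ (Set.Icc (-L) L))
    (hoverlap : (∫ x in (-L)..L, Real.sqrt (ρ x) * Ψ₀ x * ξ₀ x) ≠ 0)
    (hinit : ξ 0 = ξ₀)
    (hrec : ∀ n, ξ (n + 1) = stringIter L ρ (ξ n)) :
    ∃ s : ℝ, (s = 1 ∨ s = -1) ∧
      TendstoUniformlyOn
        (fun n x => s * ((Real.sqrt (∫ t in (-L)..L, (ξ n t) ^ 2))⁻¹ * ξ n x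
          / Real.sqrt (ρ x)))
        Ψ₀ atTop (Set.Icc (-L) L) := by
  have hLL : -L ≤ L := by linarith
  have hsqrt : ∀ x ∈ Icc (-L) L, 0 < √(ρ x) := fun x hx => Real.sqrt_pos.2 (hρpos x hx)
  -- continuous extensions of the fundamental mode and of `ξ₀ / √ρ`
  obtain ⟨Ψ, hΨc, hΨΨ₀⟩ : ∃ Ψ : ℝ → ℝ, Continuous Ψ ∧ EqOn Ψ Ψ₀ (Icc (-L) L) :=
    ⟨IccExtend hLL ((Icc (-L) L).domRestrict Ψ₀), hΨ.continuousOn.domRestrict.Icc_extend',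
      fun x hx => IccExtend_of_mem hLL _ hx⟩
  obtain ⟨f, hfc, hf⟩ : ∃ f : ℝ → ℝ, Continuous f ∧
      EqOn f (fun x => ξ₀ x / √(ρ x)) (Icc (-L) L) :=
    ⟨IccExtend hLL ((Icc (-L) L).domRestrict fun x => ξ₀ x / √(ρ x)),
      (hξ₀cont.div hρ.sqrt.continuousOn fun x hx => (hsqrt x hx).ne').domRestrict.Icc_extend',
      fun x hx => IccExtend_of_mem hLL _ hx⟩
  have hΨeq' := eq_mul_greenOp_of_eigenfunction hL hρ hΨ hΨeq hΨa hΨb hΨc hΨΨ₀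
  have hΨΨ : weightedInner L ρ Ψ Ψ = 1 := by
    rw [weightedInner_congr hL hΨΨ₀ hΨΨ₀, ← hΨnorm]
    exact intervalIntegral.integral_congr fun x _ => by ring
  have hE₀ : 0 < E₀ := by
    have hA := greenOp_continuous (L := L) hρ hΨc
    have h1 : weightedInner L ρ Ψ Ψ =
        weightedInner L ρ (fun x => E₀ * greenOp L ρ Ψ x + 0 * greenOp L ρ Ψ x) Ψ :=
      weightedInner_congr hL (fun x hx => by rw [hΨeq' x hx]; ring) fun _ _ => rfl
    rw [weightedInner_lin hρ hA hA hΨc, hΨΨ, zero_mul, add_zero] at h1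
    exact pos_of_mul_pos_left (h1 ▸ one_pos) (weightedInner_greenOp_self_nonneg hL hρ hΨc)
  have hgap : ∀ (r : ℝ) (h : ℝ → ℝ), 0 < r → Continuous h → (∃ x ∈ Icc (-L) L, h x ≠ 0) →
      (∀ x ∈ Icc (-L) L, greenOp L ρ h x = r * h x) → r⁻¹ ≠ E₀ → E₀ < r⁻¹ := by
    intro r h hr hh hne heq
    obtain ⟨ψ, h1, h2, h3, h4, h5⟩ := exists_eigenpair_of_greenOp_eq hL hρ hr.ne' hh hne heq
    exact hfund r⁻¹ ψ h1 h2 h3 h4 h5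
  have hξ : ∀ n, ∀ x ∈ Icc (-L) L, ξ n x = √(ρ x) * (greenOp L ρ)^[n] f x := fun n => by
    induction n with
    | zero =>
      intro x hx
      rw [hinit, Function.iterate_zero_apply, hf hx]
      exact (mul_div_cancel₀ _ (hsqrt x hx).ne').symm
    | succ n ih =>
      intro x hx
      rw [hrec, Function.iterate_succ_apply']
      exact stringIter_eq_greenOp hL hρpos ih hx
  set c := weightedInner L ρ f Ψ with hc
  have hc0 : c ≠ 0 := by
    convert hoverlap using 1
    refine intervalIntegral.integral_congr fun x hx => ?_
    rw [uIcc_of_le hLL] at hx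
    simp only [hf hx, hΨΨ₀ hx]
    have h1 := (hsqrt x hx).ne'
    field_simp
    rw [Real.sq_sqrt (hρpos x hx).le]
    ring
  set w : ℝ → ℝ := fun x => 1 * f x + -c * Ψ x with hw
  have hwc : Continuous w := by fun_prop
  have hwΨ : weightedInner L ρ w Ψ = 0 := by
    rw [hw, weightedInner_lin hρ hfc hΨc hΨc, hΨΨ, ← hc]
    ring
  set W : ℕ → ℝ → ℝ := fun n => (greenOp L ρ)^[n] w with hWdef
  have hWc : ∀ n, Continuous (W n) := iterate_greenOp_continuous hρ hwc
  have hWΨ : ∀ n, weightedInner L ρ (W n) Ψ = 0 :=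
    iterate_weightedInner_eq_zero hL hρ hE₀ hΨc hΨeq' hwc hwΨ
  have hdec := iterate_greenOp_decomposition hL hρ hE₀ hΨc hΨeq' hwc (f := f) (c := c)
    fun x => by rw [hw]; ring
  have hWlim : Tendsto (fun n => (E₀ ^ n) ^ 2 * weightedInner L ρ (W n) (W n)) atTop (𝓝 0) :=
    tendsto_iterate_weightedInner hL hρ hρpos hE₀ hΨc hΨeq' hΨΨ hgap hwc hwΨ
  have hpow : ∀ n, 0 < E₀ ^ n := fun n => pow_pos hE₀ n
  -- the rescaled norms converge to `|c|`
  set N : ℕ → ℝ := fun n => E₀ ^ n * √(∫ t in (-L)..L, ξ n t ^ 2) with hN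
  have hξnorm : ∀ n, (∫ t in (-L)..L, ξ n t ^ 2) =
      (c * (E₀ ^ n)⁻¹) ^ 2 + weightedInner L ρ (W n) (W n) := fun n => by
    have h1 : (∫ t in (-L)..L, ξ n t ^ 2) =
        weightedInner L ρ ((greenOp L ρ)^[n] f) ((greenOp L ρ)^[n] f) := by
      refine intervalIntegral.integral_congr fun t ht => ?_
      rw [uIcc_of_le hLL] at ht
      simp only [hξ n t ht]
      rw [mul_pow, Real.sq_sqrt (hρpos t ht).le]
      ring
    rw [h1, weightedInner_congr hL (hdec n) (hdec n), weightedInner_lin_self hρ hΨc (hWc n),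
      hΨΨ, weightedInner_comm, hWΨ]
    ring
  have hNlim : Tendsto N atTop (𝓝 |c|) := by
    have h1 := (hWlim.const_add (c ^ 2)).sqrt
    rw [add_zero, Real.sqrt_sq_eq_abs] at h1
    refine h1.congr fun n => ?_
    have h2 := (hpow n).ne'
    simp only [hN]
    rw [hξnorm, ← Real.sqrt_sq (hpow n).le, ← Real.sqrt_mul (sq_nonneg _),
      Real.sqrt_sq (hpow n).le]
    congr 1
    field_simp
  obtain ⟨M, hM⟩ := isCompact_Icc.exists_bound_of_continuousOn (s := Icc (-L) L)
    hΨc.continuousOn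
  obtain ⟨s, hs, hsc⟩ : ∃ s : ℝ, (s = 1 ∨ s = -1) ∧ s * c = |c| := by
    rcases abs_choice c with h | h
    · exact ⟨1, Or.inl rfl, by rw [h, one_mul]⟩
    · exact ⟨-1, Or.inr rfl, by rw [h, neg_one_mul]⟩
  have hs1 : |s| = 1 := by rcases hs with rfl | rfl <;> simp
  refine ⟨s, hs, ?_⟩
  have hNinv : Tendsto (fun n => (N n)⁻¹) atTop (𝓝 |c|⁻¹) := hNlim.inv₀ (abs_ne_zero.2 hc0)
  -- a uniform bound for the remainder which tends to zero
  set e : ℕ → ℝ := fun n => E₀ * (slopeBound L ρ * (2 * L)) *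
    √((E₀ ^ n) ^ 2 * weightedInner L ρ (W n) (W n)) with he
  have helim : Tendsto e atTop (𝓝 0) := by
    simpa using hWlim.sqrt.const_mul (E₀ * (slopeBound L ρ * (2 * L)))
  have hebound : ∀ n, ∀ x ∈ Icc (-L) L, |E₀ ^ (n + 1) * W (n + 1) x| ≤ e n := fun n x hx => by
    have h1 := abs_greenOp_le hL hρ hρpos (hWc n) hx
    have h2 : W (n + 1) x = greenOp L ρ (W n) x := by
      simp only [hWdef, Function.iterate_succ_apply']
    simp only [he]
    rw [h2, abs_mul, abs_of_pos (hpow _), Real.sqrt_mul (sq_nonneg _), Real.sqrt_sq (hpow n).le]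
    calc _ ≤ E₀ ^ (n + 1) * _ := mul_le_mul_of_nonneg_left h1 (hpow _).le
      _ = _ := by ring
  have hdlim : Tendsto (fun n => |(N n)⁻¹ * |c| - 1| * M + |(N n)⁻¹| * e (n - 1)) atTop
      (𝓝 0) := by
    have h1 := ((hNinv.mul_const |c|).sub_const 1).abs.mul_const M
    have h2 := hNinv.abs.mul (helim.comp (tendsto_sub_atTop_nat 1))
    simpa [hc0] using h1.add h2
  rw [Metric.tendstoUniformlyOn_iff]
  intro ε hε
  filter_upwards [hdlim.eventually_lt_const hε, eventually_ge_atTop 1] with n hn hn1 x hx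
  refine lt_of_le_of_lt ?_ hn
  obtain ⟨m, rfl⟩ : ∃ m, n = m + 1 := ⟨n - 1, by omega⟩
  have hx1 : s * ((√(∫ t in (-L)..L, ξ (m + 1) t ^ 2))⁻¹ * ξ (m + 1) x / √(ρ x)) - Ψ₀ x =
      ((N (m + 1))⁻¹ * |c| - 1) * Ψ x + s * ((N (m + 1))⁻¹ * (E₀ ^ (m + 1) * W (m + 1) x)) := by
    have h1 := (hsqrt x hx).ne'
    have h2 := (hpow (m + 1)).ne'
    rw [hξ _ x hx, hdec _ x hx, ← hΨΨ₀ hx, ← hsc]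
    simp only [hN, hWdef, mul_inv]
    field_simp
    ring
  rw [dist_comm, Real.dist_eq, hx1]
  refine (abs_add_le _ _).trans ?_
  rw [abs_mul, abs_mul s, hs1, one_mul, abs_mul (N (m + 1))⁻¹, Nat.add_sub_cancel]
  exact add_le_add (mul_le_mul_of_nonneg_left (hM x hx) (abs_nonneg _))
    (mul_le_mul_of_nonneg_left (hebound m x hx) (abs_nonneg _))
end

section
/- Let L > 0 and let ρ : ℝ → ℝ be continuous with ρ(x) > 0 on [−L,L]. Suppose Ψ₁, …, Ψ_N are C² Dirichlet eigenfunctions of the string with eigenvalues E₁ < E₂ < ⋯ < E_N, normalized so that ∫_{−L}^{L} ρ Ψ_i Ψ_j dx = δ_{ij}, and such that every other Dirichlet eigenvalue exceeds E_N. Let ξ₀^{(1)}, …, ξ₀^{(N)} be continuous functions on [−L,L] such that the N×N overlap matrix M_{ij} = ∫_{−L}^{L} √(ρ(x)) Ψ_i(x) ξ₀^{(j)}(x) dx has all its leading principal minors nonzero. Define the iteration: at step n, first set ξ_n^{(j)}(x) = √(ρ(x)) ∫_{−L}^{x} [κ_n^{(j)} − ∫_{−L}^{y} √(ρ(z)) ξ̄_{n−1}^{(j)}(z)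 dz] dy with κ_n^{(j)} = (1/(2L)) ∫_{−L}^{L} ∫_{−L}^{y} √(ρ(z)) ξ̄_{n−1}^{(j)}(z) dz dy (where ξ̄₀^{(j)} = ξ₀^{(j)}), and then Gram–Schmidt orthogonalize: ξ̄_n^{(j)} = ξ_n^{(j)} − Σ_{k=1}^{j−1} (∫_{−L}^{L} ξ̄_n^{(k)} ξ_n^{(j)} dx / ∫_{−L}^{L} (ξ̄_n^{(k)})² dx) ξ̄_n^{(k)}. Then for each j ∈ {1,…,N} there exist signs s_n^{(j)} ∈ {−1,1} such that s_n^{(j)} · ξ̄_n^{(j)}(x) / (∫_{−L}^{L} (ξ̄_n^{(j)})² dx)^{1/2} converges uniformly on [−L,L] to √(ρ(x)) Ψ_j(x) as n → ∞. -/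
open Real Set Filter intervalIntegral

section Abstract

open scoped Topology

variable {X : Type*} [NormedAddCommGroup X] [InnerProductSpace ℝ X]

/-- A nonzero symmetric operator on a real inner product space mapping bounded sequences to
sequences with convergent subsequences has an eigenvalue of modulus `‖T‖`. -/
lemma exists_eigenvector_abs_eq_opNorm (T : X →L[ℝ] X)
    (hsymm : ∀ x y, inner ℝ (T x) y = inner ℝ x (T y))
    (hcomp : ∀ u : ℕ → X, (∀ n, ‖u n‖ ≤ 1) →
      ∃ g, ∃ φ : ℕ → ℕ, StrictMono φ ∧ Tendsto (fun n => T (u (φ n))) atTop (𝓝 g))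
    (hT : ‖T‖ ≠ 0) :
    ∃ h : X, h ≠ 0 ∧ ∃ μ : ℝ, |μ| = ‖T‖ ∧ T h = μ • h := by
  set q := ‖T‖ with hq
  have hq0 : 0 < q := lt_of_le_of_ne (norm_nonneg T) (Ne.symm hT)
  have hex : ∀ n : ℕ, ∃ x : X, ‖x‖ < 1 ∧ q - 1 / ((n : ℝ) + 1) < ‖T x‖ := fun n =>
    ContinuousLinearMap.exists_lt_apply_of_lt_opNorm T
      (by have : (0 : ℝ) < 1 / ((n : ℝ) + 1) := by positivity
          linarith)
  choose u hu1 hu2 using hex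
  have hle : ∀ n, ‖T (u n)‖ ≤ q := fun n =>
    (T.le_opNorm _).trans (by nlinarith [hu1 n])
  have hlim : Tendsto (fun n => ‖T (u n)‖) atTop (𝓝 q) := by
    refine tendsto_of_tendsto_of_tendsto_of_le_of_le ?_ tendsto_const_nhds
      (fun n => (hu2 n).le) hle
    simpa using tendsto_const_nhds.sub (tendsto_one_div_add_atTop_nhds_zero_nat (𝕜 := ℝ))
  obtain ⟨g, φ, hφ, hg⟩ := hcomp u (fun n => (hu1 n).le)
  have hlimφ := hlim.comp hφ.tendsto_atTop
  have hgq : ‖g‖ = q := tendsto_nhds_unique hg.norm hlimφ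
  have hg0 : g ≠ 0 := by
    rw [← norm_ne_zero_iff, hgq]
    exact hT
  have hdefect : ∀ n, ‖T (T (u n)) - q ^ 2 • u n‖ ^ 2 ≤ q ^ 2 * (q ^ 2 - ‖T (u n)‖ ^ 2) := by
    intro n
    rw [norm_sub_sq_real, inner_smul_right, hsymm (T (u n)) (u n), real_inner_self_eq_norm_sq,
      norm_smul, norm_pow, Real.norm_of_nonneg hq0.le]
    have h1 : ‖T (T (u n))‖ ^ 2 ≤ (q * ‖T (u n)‖) ^ 2 :=
      pow_le_pow_left₀ (norm_nonneg _) (T.le_opNorm _) 2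
    have h2 : (q ^ 2 * ‖u n‖) ^ 2 ≤ (q ^ 2) ^ 2 := by
      refine pow_le_pow_left₀ (by positivity) ?_ 2
      have := (hu1 n).le
      nlinarith [sq_nonneg q]
    nlinarith
  have hdef0 : Tendsto (fun n => T (T (u n)) - q ^ 2 • u n) atTop (𝓝 0) := by
    rw [tendsto_zero_iff_norm_tendsto_zero]
    have h3 : Tendsto (fun n => q ^ 2 * (q ^ 2 - ‖T (u n)‖ ^ 2)) atTop (𝓝 0) := by
      have := (tendsto_const_nhds (x := q ^ 2)).mul
        ((tendsto_const_nhds (x := q ^ 2)).sub (hlim.pow 2))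
      simpa using this
    have h4 := squeeze_zero (fun n => sq_nonneg _) hdefect h3
    have h5 := h4.sqrt
    simpa [Real.sqrt_sq (norm_nonneg _)] using h5
  have hsq : T (T g) = q ^ 2 • g := by
    have h6 : Tendsto (fun n => T (T (T (u (φ n)))) - q ^ 2 • T (u (φ n))) atTop (𝓝 0) := by
      have := (T.continuous.tendsto 0).comp (hdef0.comp hφ.tendsto_atTop)
      simpa [Function.comp_def] using this
    have h7 : Tendsto (fun n => T (T (T (u (φ n)))) - q ^ 2 • T (u (φ n))) atTop
        (𝓝 (T (T g) - q ^ 2 • g)) :=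
      (((T.continuous.comp T.continuous).tendsto g).comp hg).sub (hg.const_smul _)
    exact sub_eq_zero.1 (tendsto_nhds_unique h7 h6)
  by_cases hz : T g + q • g = 0
  · exact ⟨g, hg0, -q, by simp [abs_of_pos hq0], by
      rw [neg_smul]
      exact eq_neg_of_add_eq_zero_left hz⟩
  · refine ⟨T g + q • g, hz, q, abs_of_pos hq0, ?_⟩
    rw [map_add, map_smul, hsq, smul_add, smul_smul, pow_two, add_comm]

/-- On a closed invariant subspace, the sharp bound of a symmetric compact operator is either zero
or the modulus of an eigenvalue. -/
lemma exists_sharp_bound_on_invariant (T : X →L[ℝ] X)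
    (hsymm : ∀ x y, inner ℝ (T x) y = inner ℝ x (T y))
    (hcomp : ∀ u : ℕ → X, (∀ n, ‖u n‖ ≤ 1) →
      ∃ g, ∃ φ : ℕ → ℕ, StrictMono φ ∧ Tendsto (fun n => T (u (φ n))) atTop (𝓝 g))
    (V : Submodule ℝ X) (hV : IsClosed (V : Set X)) (hinv : ∀ x ∈ V, T x ∈ V) :
    ∃ q : ℝ, 0 ≤ q ∧ (∀ x ∈ V, ‖T x‖ ≤ q * ‖x‖) ∧
      (q = 0 ∨ ∃ h ∈ V, h ≠ 0 ∧ ∃ μ : ℝ, |μ| = q ∧ T h = μ • h) := by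
  let T' : V →L[ℝ] V := (T.comp V.subtypeL).codRestrict V (fun x => hinv x x.2)
  have hT' : ∀ x : V, ((T' x : V) : X) = T x := fun x => rfl
  refine ⟨‖T'‖, T'.opNorm_nonneg, fun x hx => T'.le_opNorm ⟨x, hx⟩, ?_⟩
  by_cases h0 : ‖T'‖ = 0
  · exact Or.inl h0
  right
  obtain ⟨h, hh, μ, hμ, he⟩ := exists_eigenvector_abs_eq_opNorm T'
    (fun x y => hsymm x y) (by
      intro u hu
      obtain ⟨g, φ, hφ, hg⟩ := hcomp (fun n => u n) hu
      have hgV : g ∈ V := hV.mem_of_tendsto hg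
        (Eventually.of_forall fun n => hinv _ (u (φ n)).2)
      exact ⟨⟨g, hgV⟩, φ, hφ, tendsto_subtype_rng.2 hg⟩) h0
  exact ⟨h, h.2, fun hc => hh (Subtype.ext hc), μ, hμ, congrArg Subtype.val he⟩

variable {Y : Type*} [NormedAddCommGroup Y] [NormedSpace ℝ Y]

/-- One Gram–Schmidt sweep of the vectors `S (x n j)` gives the vectors `x (n + 1) j`, with inner
products taken after applying `ι`. -/
def IsGramSchmidtIteration {N : ℕ} (ι : Y →L[ℝ] X) (S : Y →ₗ[ℝ] Y) (x : ℕ → Fin N → Y) : Prop :=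
  ∀ n j, x (n + 1) j = S (x n j) - ∑ k ∈ Finset.Iio j,
    (inner ℝ (ι (x (n + 1) k)) (ι (S (x n j))) / ‖ι (x (n + 1) k)‖ ^ 2) • x (n + 1) k

variable {N : ℕ} {ι : Y →L[ℝ] X} {S : Y →ₗ[ℝ] Y} {x : ℕ → Fin N → Y}

lemma div_norm_sq_mul_norm_sq (a b : X) : inner ℝ a b / ‖a‖ ^ 2 * ‖a‖ ^ 2 = inner ℝ a b := by
  by_cases ha : a = 0
  · simp [ha]
  · exact div_mul_cancel₀ _ (pow_ne_zero 2 (norm_ne_zero_iff.2 ha))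

lemma IsGramSchmidtIteration.orthogonal (hx : IsGramSchmidtIteration ι S x) (n : ℕ) :
    ∀ j k : Fin N, k < j → inner ℝ (ι (x (n + 1) k)) (ι (x (n + 1) j)) = 0 := by
  intro j
  induction j using WellFoundedLT.induction with
  | ind j ih =>
    intro k hk
    rw [hx n j, map_sub, inner_sub_right, map_sum, inner_sum,
      Finset.sum_eq_single_of_mem k (Finset.mem_Iio.2 hk)]
    · rw [map_smul, inner_smul_right, real_inner_self_eq_norm_sq, div_norm_sq_mul_norm_sq, sub_self]
    · intro l hl hlk
      rw [map_smul, inner_smul_right]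
      rcases lt_or_gt_of_ne hlk with h | h
      · rw [real_inner_comm (ι (x (n + 1) l)) (ι (x (n + 1) k)), ih k hk l h, mul_zero]
      · rw [ih l (Finset.mem_Iio.1 hl) k h, mul_zero]

lemma sum_Iic_eq_add_sum_Iio {M : Type*} [AddCommMonoid M] (j : Fin N) (f : Fin N → M) :
    ∑ k ∈ Finset.Iic j, f k = f j + ∑ k ∈ Finset.Iio j, f k := by
  rw [← Finset.Iio_insert, Finset.sum_insert (by simp)]

lemma IsGramSchmidtIteration.exists_expansion (hx : IsGramSchmidtIteration ι S x) (j : Fin N)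
    (c : Fin N → ℝ) (n : ℕ) :
    ∃ d : Fin N → ℝ, d j = c j ∧
      (S ^ n) (∑ k ∈ Finset.Iic j, c k • x 0 k) = ∑ k ∈ Finset.Iic j, d k • x n k := by
  induction n with
  | zero => exact ⟨c, rfl, rfl⟩
  | succ n ih =>
    obtain ⟨d, hd, he⟩ := ih
    set a : Fin N → Fin N → ℝ := fun k l =>
      inner ℝ (ι (x (n + 1) l)) (ι (S (x n k))) / ‖ι (x (n + 1) l)‖ ^ 2 with ha
    have hS : ∀ k, S (x n k) = x (n + 1) k + ∑ l ∈ Finset.Iio k, a k l • x (n + 1) l := fun k => by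
      rw [hx n k]; simp [ha]
    refine ⟨fun l => d l + ∑ k ∈ Finset.Iic j, if l < k then d k * a k l else 0, ?_, ?_⟩
    · have : ∑ k ∈ Finset.Iic j, (if j < k then d k * a k j else 0) = 0 :=
        Finset.sum_eq_zero fun k hk => if_neg (not_lt.2 (Finset.mem_Iic.1 hk))
      simp only [this, hd, add_zero]
    · rw [pow_succ', Module.End.mul_apply, he, map_sum]
      simp only [map_smul, add_smul, Finset.sum_add_distrib, Finset.sum_smul]
      rw [Finset.sum_comm, ← Finset.sum_add_distrib]
      refine Finset.sum_congr rfl fun k hk => ?_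
      rw [hS k, smul_add, Finset.smul_sum]
      congr 1
      rw [← Finset.sum_filter_add_sum_filter_not (Finset.Iic j) (fun l => l < k)]
      rw [Finset.sum_eq_zero (s := (Finset.Iic j).filter (fun l => ¬ l < k))
        (fun l hl => by rw [if_neg (Finset.mem_filter.1 hl).2, zero_smul]), add_zero]
      have : (Finset.Iic j).filter (fun l => l < k) = Finset.Iio k := by
        ext l
        simp only [Finset.mem_filter, Finset.mem_Iic, Finset.mem_Iio]
        exact ⟨fun h => h.2, fun h => ⟨h.le.trans (Finset.mem_Iic.1 hk), h⟩⟩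
      rw [this]
      refine Finset.sum_congr rfl fun l hl => ?_
      rw [if_pos (Finset.mem_Iio.1 hl), smul_smul]

/-- If suitable rescaled iterates of combinations of `x 0 k`, `k ≤ j`, converge to an orthonormal
family, then so do the normalized Gram–Schmidt iterates, up to signs. -/
theorem IsGramSchmidtIteration.tendsto_normalized (hx : IsGramSchmidtIteration ι S x)
    (hι : Function.Injective ι) {φ : Fin N → Y} (hφ : Orthonormal ℝ (fun i => ι (φ i)))
    {E : Fin N → ℝ} (hE : ∀ j, 0 < E j)
    (c : Fin N → Fin N → ℝ) (hc : ∀ j, c j j ≠ 0)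
    (hlim : ∀ j, Tendsto (fun n => E j ^ n • (S ^ n) (∑ k ∈ Finset.Iic j, c j k • x 0 k)) atTop
      (𝓝 (φ j))) (j : Fin N) :
    ∃ s : ℝ, (s = 1 ∨ s = -1) ∧
      Tendsto (fun n => s • ‖ι (x n j)‖⁻¹ • x n j) atTop (𝓝 (φ j)) := by
  induction j using WellFoundedLT.induction with
  | ind j ih =>
    choose! s hs1 hs2 using ih
    set y : ℕ → Y := fun n => E j ^ n • (S ^ n) (∑ k ∈ Finset.Iic j, c j k • x 0 k) with hy
    have hyφ : Tendsto y atTop (𝓝 (φ j)) := hlim j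
    set z : ℕ → Y := fun n => (c j j * E j ^ n) • x n j with hz
    have hzy : ∀ n, z (n + 1) = y (n + 1) - ∑ k ∈ Finset.Iio j,
        inner ℝ (ι (s k • ‖ι (x (n + 1) k)‖⁻¹ • x (n + 1) k)) (ι (y (n + 1))) •
          (s k • ‖ι (x (n + 1) k)‖⁻¹ • x (n + 1) k) := by
      intro n
      obtain ⟨d, hd, he⟩ := hx.exists_expansion j (c j) (n + 1)
      have hyexp : y (n + 1) = z (n + 1) +
          ∑ k ∈ Finset.Iio j, (E j ^ (n + 1) * d k) • x (n + 1) k := by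
        simp only [hy, hz, he]
        rw [sum_Iic_eq_add_sum_Iio, smul_add, smul_smul, hd, mul_comm, Finset.smul_sum]
        simp only [smul_smul]
      have hin : ∀ k ∈ Finset.Iio j, inner ℝ (ι (x (n + 1) k)) (ι (y (n + 1))) =
          E j ^ (n + 1) * d k * ‖ι (x (n + 1) k)‖ ^ 2 := by
        intro k hk
        rw [hyexp, map_add, inner_add_right, map_sum, inner_sum, hz, map_smul, inner_smul_right,
          hx.orthogonal n j k (Finset.mem_Iio.1 hk), mul_zero, zero_add,
          Finset.sum_eq_single_of_mem k hk]
        · rw [map_smul, inner_smul_right, real_inner_self_eq_norm_sq]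
        · intro l hl hlk
          rw [map_smul, inner_smul_right]
          rcases lt_or_gt_of_ne hlk with h | h
          · rw [real_inner_comm (ι (x (n + 1) l)) (ι (x (n + 1) k)),
              hx.orthogonal n k l h, mul_zero]
          · rw [hx.orthogonal n l k h, mul_zero]
      rw [eq_sub_iff_add_eq, hyexp, ← hyexp]
      nth_rewrite 2 [hyexp]
      congr 1
      refine Finset.sum_congr rfl fun k hk => ?_
      rw [map_smul, map_smul, inner_smul_left, inner_smul_left, hin k hk, smul_smul, smul_smul]
      have hs : s k * s k = 1 := by
        rcases hs1 k (Finset.mem_Iio.1 hk) with h | h <;> rw [h] <;> norm_num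
      by_cases h0 : ι (x (n + 1) k) = 0
      · rw [(map_eq_zero_iff ι hι).1 h0, smul_zero, smul_zero]
      · congr 1
        have := norm_ne_zero_iff.2 h0
        simp only [conj_trivial]
        field_simp
        linear_combination (d k * E j ^ (n + 1)) * hs
    have hzφ : Tendsto z atTop (𝓝 (φ j)) := by
      rw [← tendsto_add_atTop_iff_nat 1]
      simp only [hzy]
      have hy1 := (tendsto_add_atTop_iff_nat 1).2 hyφ
      have : φ j = φ j - ∑ k ∈ Finset.Iio j, inner ℝ (ι (φ k)) (ι (φ j)) • φ k := by
        rw [Finset.sum_eq_zero, sub_zero]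
        intro k hk
        rw [hφ.2 (Finset.mem_Iio.1 hk).ne, zero_smul]
      rw [this]
      refine hy1.sub (tendsto_finsetSum _ fun k hk => ?_)
      have hk1 := (tendsto_add_atTop_iff_nat 1).2 (hs2 k (Finset.mem_Iio.1 hk))
      exact (((ι.continuous.tendsto _).comp hk1).inner ((ι.continuous.tendsto _).comp hy1)).smul hk1
    have hnorm : Tendsto (fun n => ‖ι (z n)‖⁻¹ • z n) atTop (𝓝 (φ j)) := by
      have h1 : Tendsto (fun n => ‖ι (z n)‖) atTop (𝓝 1) := by
        rw [← hφ.1 j]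
        exact ((ι.continuous.tendsto _).comp hzφ).norm
      simpa using (h1.inv₀ one_ne_zero).smul hzφ
    have hsame : ∀ n, ‖ι (z n)‖⁻¹ • z n = (c j j / |c j j|) • ‖ι (x n j)‖⁻¹ • x n j := by
      intro n
      have hp : 0 < E j ^ n := pow_pos (hE j) n
      have hcj := abs_pos.2 (hc j)
      simp only [hz, map_smul, norm_smul, smul_smul, norm_mul, Real.norm_eq_abs, abs_of_pos hp]
      congr 1
      rw [mul_inv, mul_inv]
      field_simp
    refine ⟨c j j / |c j j|, ?_, by simpa only [hsame] using hnorm⟩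
    rcases lt_or_gt_of_ne (hc j) with h | h
    · right; rw [abs_of_neg h, div_neg, div_self (hc j)]
    · left; rw [abs_of_pos h, div_self (hc j)]

/-- A combination `∑ k ≤ j, c k • x k` with `c j ≠ 0` that is dual to the first `j + 1` members of
`φ`, provided the leading principal minors of the overlap matrix are nonzero. -/
lemma exists_dual_combination (φ x : Fin N → X)
    (hminors : ∀ (m : ℕ) (hm : m ≤ N), Matrix.det (Matrix.of fun i j : Fin m =>
      inner ℝ (φ (Fin.castLE hm i)) (x (Fin.castLE hm j))) ≠ 0) (j : Fin N) :
    ∃ c : Fin N → ℝ, c j ≠ 0 ∧ ∀ i ≤ j,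
      inner ℝ (φ i) (∑ k ∈ Finset.Iic j, c k • x k) = if i = j then 1 else 0 := by
  have hm : (j : ℕ) + 1 ≤ N := j.2
  set M := Matrix.of fun i k : Fin ((j : ℕ) + 1) =>
    inner ℝ (φ (Fin.castLE hm i)) (x (Fin.castLE hm k)) with hM
  have hunit : IsUnit M.det := isUnit_iff_ne_zero.2 (hminors _ hm)
  set e : Fin ((j : ℕ) + 1) → ℝ := fun i => if i = Fin.last j then 1 else 0 with he
  set v := M⁻¹.mulVec e with hv
  have hMv : M.mulVec v = e := by
    rw [hv, Matrix.mulVec_mulVec, Matrix.mul_nonsing_inv _ hunit, Matrix.one_mulVec]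
  have hlast : v (Fin.last j) ≠ 0 := by
    intro h0
    have hker : (Matrix.of fun i k : Fin (j : ℕ) =>
        inner ℝ (φ (Fin.castLE j.2.le i)) (x (Fin.castLE j.2.le k))).mulVec
        (fun k => v k.castSucc) = 0 := by
      ext i
      have h1 := congrFun hMv i.castSucc
      simp only [Matrix.mulVec, dotProduct, Fin.sum_univ_castSucc, h0, mul_zero, add_zero, he,
        (Fin.castSucc_lt_last i).ne, if_false] at h1
      simpa [Matrix.mulVec, dotProduct, hM] using h1
    have hz := Matrix.eq_zero_of_mulVec_eq_zero (hminors _ j.2.le) hker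
    have hv0 : v = 0 := by
      ext k
      refine Fin.lastCases h0 (fun i => congrFun hz i) k
    have := congrFun hMv (Fin.last j)
    rw [hv0, Matrix.mulVec_zero] at this
    simp [he] at this
  refine ⟨fun k => if h : (k : ℕ) < (j : ℕ) + 1 then v ⟨k, h⟩ else 0, ?_, ?_⟩
  · simpa [Fin.last] using hlast
  · intro i hi
    have hi' : (i : ℕ) < (j : ℕ) + 1 := Nat.lt_succ_of_le hi
    have h1 := congrFun hMv ⟨i, hi'⟩
    have himg : Finset.Iic j = Finset.univ.map (Fin.castLEEmb hm) := by
      ext k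
      simp only [Finset.mem_Iic, Finset.mem_map, Finset.mem_univ, true_and]
      constructor
      · intro hk
        exact ⟨⟨k, Nat.lt_succ_of_le hk⟩, rfl⟩
      · rintro ⟨l, rfl⟩
        exact Nat.lt_succ_iff.1 l.2
    rw [himg, Finset.sum_map, inner_sum]
    have h2 : e ⟨i, hi'⟩ = if i = j then 1 else 0 := by
      simp [he, Fin.ext_iff]
    rw [← h2, ← h1]
    simp only [Matrix.mulVec, dotProduct, hM, Matrix.of_apply, inner_smul_right]
    refine Finset.sum_congr rfl fun k _ => ?_
    have hk : ((Fin.castLEEmb hm k : Fin N) : ℕ) < (j : ℕ) + 1 := k.2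
    rw [dif_pos hk, mul_comm]
    rfl

/-- If `S = K ∘ ι` contracts by a factor `q < E⁻¹` on the orthogonal complement of the
eigenvectors `φ i`, `i ≤ j`, then rescaled iterates of a vector dual to them converge. -/
lemma tendsto_rescaled_iterate (ι : Y →L[ℝ] X) (K : X →L[ℝ] Y)
    (hsymm : ∀ u v, inner ℝ (ι (K u)) v = inner ℝ u (ι (K v)))
    {φ : Fin N → Y} (hφ : Orthonormal ℝ (fun i => ι (φ i))) {E : Fin N → ℝ} (hE : ∀ j, 0 < E j)
    (heig : ∀ i, K (ι (φ i)) = (E i)⁻¹ • φ i) (j : Fin N) {q : ℝ} (hq0 : 0 ≤ q) (hq : E j * q < 1)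
    (hbound : ∀ u, (∀ i ≤ j, inner ℝ (ι (φ i)) u = 0) → ‖ι (K u)‖ ≤ q * ‖u‖)
    {η : Y} (hη : ∀ i ≤ j, inner ℝ (ι (φ i)) (ι η) = if i = j then 1 else 0) :
    Tendsto (fun n => E j ^ n • ((K.comp ι : Y →L[ℝ] Y) : Y →ₗ[ℝ] Y) ^ n • η) atTop
      (𝓝 (φ j)) := by
  set S : Y →ₗ[ℝ] Y := ((K.comp ι : Y →L[ℝ] Y) : Y →ₗ[ℝ] Y) with hS
  have hSapp : ∀ u, S u = K (ι u) := fun u => rfl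
  set r := η - φ j with hr
  have hr0 : ∀ i ≤ j, inner ℝ (ι (φ i)) (ι r) = 0 := by
    intro i hi
    rw [hr, map_sub, inner_sub_right, hη i hi, (orthonormal_iff_ite.1 hφ) i j, sub_self]
  have hinv : ∀ n, (∀ i ≤ j, inner ℝ (ι (φ i)) (ι ((S ^ n) r)) = 0) ∧
      ‖ι ((S ^ n) r)‖ ≤ q ^ n * ‖ι r‖ := by
    intro n
    induction n with
    | zero => exact ⟨hr0, by simp⟩
    | succ n ih =>
      rw [pow_succ', Module.End.mul_apply, hSapp]
      refine ⟨fun i hi => ?_, ?_⟩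
      · rw [← hsymm, heig, map_smul, inner_smul_left, ih.1 i hi, mul_zero]
      · refine (hbound _ ih.1).trans ?_
        rw [pow_succ', mul_assoc]
        exact mul_le_mul_of_nonneg_left ih.2 hq0
  have hφn : ∀ n, E j ^ n • (S ^ n) (φ j) = φ j := by
    intro n
    induction n with
    | zero => simp
    | succ n ih =>
      rw [pow_succ (S), Module.End.mul_apply, hSapp, heig, map_smul, smul_smul, pow_succ, mul_assoc,
        mul_inv_cancel₀ (hE j).ne', mul_one, ih]
  have hrn : Tendsto (fun n => E j ^ n • (S ^ n) r) atTop (𝓝 0) := by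
    rw [← tendsto_add_atTop_iff_nat 1]
    refine squeeze_zero_norm (a := fun n => (E j * ‖K‖ * ‖ι r‖) * (E j * q) ^ n) (fun n => ?_) ?_
    · rw [pow_succ' S, Module.End.mul_apply, hSapp, norm_smul, norm_pow,
        Real.norm_of_nonneg (hE j).le]
      have h1 : ‖K (ι ((S ^ n) r))‖ ≤ ‖K‖ * (q ^ n * ‖ι r‖) :=
        (K.le_opNorm _).trans (mul_le_mul_of_nonneg_left (hinv n).2 K.opNorm_nonneg)
      calc E j ^ (n + 1) * ‖K (ι ((S ^ n) r))‖
          ≤ E j ^ (n + 1) * (‖K‖ * (q ^ n * ‖ι r‖)) :=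
            mul_le_mul_of_nonneg_left h1 (pow_nonneg (hE j).le _)
        _ = (E j * ‖K‖ * ‖ι r‖) * (E j * q) ^ n := by rw [mul_pow]; ring
    · simpa using (tendsto_pow_atTop_nhds_zero_of_lt_one (mul_nonneg (hE j).le hq0) hq).const_mul
        (E j * ‖K‖ * ‖ι r‖)
  have hsplit : ∀ n, E j ^ n • (S ^ n) η = φ j + E j ^ n • (S ^ n) r := by
    intro n
    rw [hr, map_sub, smul_sub, hφn]
    abel
  have := (tendsto_const_nhds (x := φ j)).add hrn
  rw [add_zero] at this
  exact this.congr fun n => (hsplit n).symm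

/-- Abstract convergence of inverse iteration combined with Gram–Schmidt: here `ι ∘ K` is a
symmetric compact operator whose eigenvalues, on the orthogonal complement of `φ i` for `i ≤ j`,
are smaller than `(E j)⁻¹` in absolute value. -/
theorem IsGramSchmidtIteration.tendsto_eigenvectors (ι : Y →L[ℝ] X) (K : X →L[ℝ] Y)
    (hι : Function.Injective ι)
    (hx : IsGramSchmidtIteration ι ((K.comp ι : Y →L[ℝ] Y) : Y →ₗ[ℝ] Y) x)
    (hsymm : ∀ u v, inner ℝ (ι (K u)) v = inner ℝ u (ι (K v)))
    (hcomp : ∀ u : ℕ → X, (∀ n, ‖u n‖ ≤ 1) →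
      ∃ g, ∃ φ : ℕ → ℕ, StrictMono φ ∧ Tendsto (fun n => ι (K (u (φ n)))) atTop (𝓝 g))
    {φ : Fin N → Y} (hφ : Orthonormal ℝ (fun i => ι (φ i))) {E : Fin N → ℝ} (hE : ∀ j, 0 < E j)
    (heig : ∀ i, K (ι (φ i)) = (E i)⁻¹ • φ i)
    (hgap : ∀ j, ∀ h : X, h ≠ 0 → (∀ i ≤ j, inner ℝ (ι (φ i)) h = 0) → ∀ μ : ℝ, μ ≠ 0 →
      ι (K h) = μ • h → |μ| < (E j)⁻¹)
    (hminors : ∀ (m : ℕ) (hm : m ≤ N), Matrix.det (Matrix.of fun i j : Fin m =>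
      inner ℝ (ι (φ (Fin.castLE hm i))) (ι (x 0 (Fin.castLE hm j)))) ≠ 0) (j : Fin N) :
    ∃ s : ℝ, (s = 1 ∨ s = -1) ∧
      Tendsto (fun n => s • ‖ι (x n j)‖⁻¹ • x n j) atTop (𝓝 (φ j)) := by
  choose c hc hdual using exists_dual_combination (fun i => ι (φ i)) (fun i => ι (x 0 i)) hminors
  refine hx.tendsto_normalized hι hφ hE c hc (fun j => ?_) j
  let V : Submodule ℝ X := (Submodule.span ℝ ((fun i => ι (φ i)) '' Set.Iic j))ᗮ
  have hV : ∀ u, u ∈ V ↔ ∀ i ≤ j, inner ℝ (ι (φ i)) u = 0 := by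
    intro u
    rw [Submodule.mem_orthogonal]
    constructor
    · intro h i hi
      exact h _ (Submodule.subset_span ⟨i, hi, rfl⟩)
    · intro h v hv
      induction hv using Submodule.span_induction with
      | mem v hv =>
        obtain ⟨i, hi, rfl⟩ := hv
        exact h i hi
      | zero => exact inner_zero_left _
      | add a b _ _ ha hb => rw [inner_add_left, ha, hb, add_zero]
      | smul t a _ ha => rw [inner_smul_left, ha, mul_zero]
  obtain ⟨q, hq0, hbound, hq⟩ := exists_sharp_bound_on_invariant (ι.comp K) hsymm hcomp V
    (Submodule.isClosed_orthogonal _) (by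
      intro u hu
      rw [hV] at hu ⊢
      intro i hi
      rw [ContinuousLinearMap.comp_apply, ← hsymm, heig, map_smul, inner_smul_left, hu i hi,
        mul_zero])
  refine tendsto_rescaled_iterate ι K hsymm hφ hE heig j hq0 ?_
    (fun u hu => hbound u ((hV u).2 hu)) (η := ∑ k ∈ Finset.Iic j, c j k • x 0 k) ?_
  · rcases hq with hq | ⟨h, hhV, hh, μ, hμ, he⟩
    · simp [hq]
    · by_cases hμ0 : μ = 0
      · simp [← hμ, hμ0]
      · have h1 := hgap j h hh ((hV h).1 hhV) μ hμ0 he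
        rw [hμ, ← one_div, lt_div_iff₀ (hE j)] at h1
        linarith
  · intro i hi
    rw [map_sum]
    simpa only [map_smul] using hdual j i hi

end Abstract

section BoundaryValueProblem

open scoped Topology

/-- The derivative of the solution `bvpSol L v` of the Dirichlet problem `-w'' = v`. -/
noncomputable def bvpSlope (L : ℝ) (v : ℝ → ℝ) (y : ℝ) : ℝ :=
  ((1 / (2 * L)) * ∫ u in (-L)..L, ∫ z in (-L)..u, v z) - ∫ z in (-L)..y, v z

/-- The solution of `-w'' = v`, `w (-L) = w L = 0`. -/
noncomputable def bvpSol (L : ℝ) (v : ℝ → ℝ) (x : ℝ) : ℝ :=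
  ∫ y in (-L)..x, bvpSlope L v y

variable {L : ℝ} {v : ℝ → ℝ}

lemma hasDerivAt_bvpSlope (hv : Continuous v) (x : ℝ) :
    HasDerivAt (bvpSlope L v) (-v x) x := by
  exact (hv.integral_hasStrictDerivAt (-L) x).hasDerivAt.const_sub _

lemma continuous_bvpSlope (hv : Continuous v) : Continuous (bvpSlope L v) :=
  continuous_iff_continuousAt.2 fun x => (hasDerivAt_bvpSlope hv x).continuousAt

lemma hasDerivAt_bvpSol (hv : Continuous v) (x : ℝ) :
    HasDerivAt (bvpSol L v) (bvpSlope L v x) x :=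
  ((continuous_bvpSlope hv).integral_hasStrictDerivAt (-L) x).hasDerivAt

lemma continuous_bvpSol (hv : Continuous v) : Continuous (bvpSol L v) :=
  continuous_iff_continuousAt.2 fun x => (hasDerivAt_bvpSol hv x).continuousAt

lemma continuous_primitive_from (hv : Continuous v) (a : ℝ) :
    Continuous fun u => ∫ z in a..u, v z :=
  continuous_iff_continuousAt.2 fun x => (hv.integral_hasStrictDerivAt a x).hasDerivAt.continuousAt

lemma bvpSol_left : bvpSol L v (-L) = 0 := integral_same

lemma bvpSol_right (hL : 0 < L) (hv : Continuous v) : bvpSol L v L = 0 := by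
  have hc := continuous_primitive_from hv (-L)
  unfold bvpSol bvpSlope
  rw [integral_sub (by simp) (hc.intervalIntegrable _ _), integral_const, smul_eq_mul]
  field_simp
  ring

lemma contDiff_two_bvpSol (hv : Continuous v) : ContDiff ℝ 2 (bvpSol L v) := by
  have h1 : deriv (bvpSol L v) = bvpSlope L v := funext fun x => (hasDerivAt_bvpSol hv x).deriv
  have h2 : deriv (bvpSlope L v) = fun x => -v x := funext fun x => (hasDerivAt_bvpSlope hv x).deriv
  have h3 : ContDiff ℝ 1 (bvpSlope L v) := by
    rw [contDiff_one_iff_deriv, h2]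
    exact ⟨fun x => (hasDerivAt_bvpSlope hv x).differentiableAt, hv.neg⟩
  have : (2 : WithTop ℕ∞) = 1 + 1 := by norm_num
  rw [this, contDiff_succ_iff_deriv, h1]
  exact ⟨fun x => (hasDerivAt_bvpSol hv x).differentiableAt, by simp, h3⟩

lemma iteratedDerivWithin_two_bvpSol (hL : 0 < L) (hv : Continuous v) {x : ℝ}
    (hx : x ∈ Icc (-L) L) : iteratedDerivWithin 2 (bvpSol L v) (Icc (-L) L) x = -v x := by
  have h1 : deriv (bvpSol L v) = bvpSlope L v := funext fun x => (hasDerivAt_bvpSol hv x).deriv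
  rw [iteratedDerivWithin_eq_iteratedDeriv (uniqueDiffOn_Icc (by linarith))
    (contDiff_two_bvpSol hv).contDiffAt hx, iteratedDeriv_succ, iteratedDeriv_one, h1]
  exact (hasDerivAt_bvpSlope hv x).deriv

lemma bvpSol_add {u : ℝ → ℝ} (hu : Continuous u) (hv : Continuous v) :
    bvpSol L (fun x => u x + v x) = fun x => bvpSol L u x + bvpSol L v x := by
  have h : bvpSlope L (fun x => u x + v x) = fun x => bvpSlope L u x + bvpSlope L v x := by
    ext y
    simp only [bvpSlope]
    simp only [integral_add (hu.intervalIntegrable _ _) (hv.intervalIntegrable _ _)]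
    rw [integral_add ((continuous_primitive_from hu _).intervalIntegrable _ _)
      ((continuous_primitive_from hv _).intervalIntegrable _ _)]
    ring
  ext x
  simp only [bvpSol, h]
  exact integral_add ((continuous_bvpSlope hu).intervalIntegrable _ _)
    ((continuous_bvpSlope hv).intervalIntegrable _ _)

lemma bvpSol_const_mul (c : ℝ) : bvpSol L (fun x => c * v x) = fun x => c * bvpSol L v x := by
  have h : bvpSlope L (fun x => c * v x) = fun x => c * bvpSlope L v x := by
    ext y
    simp only [bvpSlope, integral_const_mul]
    ring
  ext x
  simp only [bvpSol, h, integral_const_mul]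

lemma bvpSol_congr {u : ℝ → ℝ} (hL : 0 < L) (huv : EqOn u v (Icc (-L) L)) :
    EqOn (bvpSol L u) (bvpSol L v) (Icc (-L) L) := by
  have h0 : ∀ y ∈ Icc (-L) L, (∫ z in (-L)..y, u z) = ∫ z in (-L)..y, v z := fun y hy =>
    integral_congr fun z hz => by
      rw [uIcc_of_le hy.1] at hz
      exact huv ⟨hz.1, hz.2.trans hy.2⟩
  have h1 : (∫ y in (-L)..L, ∫ z in (-L)..y, u z) = ∫ y in (-L)..L, ∫ z in (-L)..y, v z :=
    integral_congr fun y hy => by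
      rw [uIcc_of_le (by linarith)] at hy
      exact h0 y hy
  intro x hx
  refine integral_congr fun y hy => ?_
  rw [uIcc_of_le hx.1] at hy
  simp only [bvpSlope, h1, h0 y ⟨hy.1, hy.2.trans hx.2⟩]

/-- Green's identity for the Dirichlet problem. -/
lemma integral_bvpSol_mul {u : ℝ → ℝ} (hL : 0 < L) (hu : Continuous u) (hv : Continuous v) :
    ∫ x in (-L)..L, bvpSol L u x * v x = ∫ x in (-L)..L, bvpSlope L u x * bvpSlope L v x := by
  have h := integral_mul_deriv_eq_deriv_mul (a := -L) (b := L)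
    (fun x _ => hasDerivAt_bvpSol (L := L) hu x) (fun x _ => hasDerivAt_bvpSlope (L := L) hv x)
    ((continuous_bvpSlope hu).intervalIntegrable _ _) (hv.neg.intervalIntegrable _ _)
  rw [bvpSol_left, bvpSol_right hL hu] at h
  simp only [mul_neg, intervalIntegral.integral_neg, zero_mul, sub_zero, zero_sub, neg_inj] at h
  exact h

lemma abs_bvpSlope_le (hL : 0 < L) (hv : Continuous v) {y : ℝ} (hy : y ∈ Icc (-L) L) :
    |bvpSlope L v y| ≤ 2 * ∫ z in (-L)..L, |v z| := by
  set I := ∫ z in (-L)..L, |v z| with hI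
  have h1 : ∀ y ∈ Icc (-L) L, |∫ z in (-L)..y, v z| ≤ I := fun y hy =>
    (abs_integral_le_integral_abs hy.1).trans
      (integral_mono_interval le_rfl hy.1 hy.2 (Eventually.of_forall fun z => abs_nonneg (v z))
        (hv.abs.intervalIntegrable _ _))
  have h2 : |∫ u in (-L)..L, ∫ z in (-L)..u, v z| ≤ I * (2 * L) := by
    have := norm_integral_le_of_norm_le_const (a := -L) (b := L) (C := I)
      (f := fun u => ∫ z in (-L)..u, v z) (fun u hu => by
        rw [uIoc_of_le (by linarith)] at hu
        exact h1 u ⟨hu.1.le, hu.2⟩)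
    rwa [Real.norm_eq_abs, sub_neg_eq_add, abs_of_pos (by linarith : 0 < L + L), ← two_mul] at this
  have h3 : |1 / (2 * L) * ∫ u in (-L)..L, ∫ z in (-L)..u, v z| ≤ I := by
    rw [abs_mul, abs_of_pos (by positivity : 0 < 1 / (2 * L)), one_div_mul_eq_div,
      div_le_iff₀ (by positivity)]
    exact h2
  calc |bvpSlope L v y| ≤ _ := abs_sub _ _
    _ ≤ 2 * I := by linarith [h1 y hy]

lemma abs_bvpSol_sub_le (hL : 0 < L) (hv : Continuous v) {x y : ℝ} (hx : x ∈ Icc (-L) L)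
    (hy : y ∈ Icc (-L) L) :
    |bvpSol L v y - bvpSol L v x| ≤ (2 * ∫ z in (-L)..L, |v z|) * |y - x| :=
  Convex.norm_image_sub_le_of_norm_hasDerivWithin_le
    (fun z _ => (hasDerivAt_bvpSol hv z).hasDerivWithinAt)
    (fun _ hz => abs_bvpSlope_le hL hv hz) (convex_Icc _ _) hx hy

lemma abs_bvpSol_le (hL : 0 < L) (hv : Continuous v) {x : ℝ} (hx : x ∈ Icc (-L) L) :
    |bvpSol L v x| ≤ 4 * L * ∫ z in (-L)..L, |v z| := by
  have h := abs_bvpSol_sub_le hL hv (left_mem_Icc.2 (by linarith)) hx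
  have hI : 0 ≤ ∫ z in (-L)..L, |v z| :=
    integral_nonneg (by linarith) fun z _ => abs_nonneg _
  rw [bvpSol_left, sub_zero] at h
  have h2 : |x - -L| ≤ 2 * L := by
    rw [abs_of_nonneg (by linarith [hx.1])]
    linarith [hx.2]
  nlinarith

end BoundaryValueProblem

section LinearODE

/-- Uniqueness for the initial value problem `d'' = g d`, `d a = d' a = 0`. -/
lemma eq_zero_of_second_order_ode {a b M : ℝ} {d d' g : ℝ → ℝ}
    (hd : ∀ x ∈ Icc a b, HasDerivWithinAt d (d' x) (Icc a b) x)
    (hd' : ∀ x ∈ Icc a b, HasDerivWithinAt d' (g x * d x) (Icc a b) x)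
    (hg : ∀ x ∈ Icc a b, |g x| ≤ M) (h0 : d a = 0) (h0' : d' a = 0) :
    ∀ x ∈ Icc a b, d x = 0 := by
  have hpair : ∀ x ∈ Icc a b,
      HasDerivWithinAt (fun x => (d x, d' x)) (d' x, g x * d x) (Icc a b) x :=
    fun x hx => (hd x hx).prodMk (hd' x hx)
  have hz := eq_zero_of_abs_deriv_le_mul_abs_self_of_eq_zero_right (a := a) (b := b)
    (K := max 1 M) (f := fun x => (d x, d' x)) (f' := fun x => (d' x, g x * d x))
    (fun x hx => (hpair x hx).continuousWithinAt)
    (fun x hx => (hpair x (Ico_subset_Icc_self hx)).mono_of_mem_nhdsWithin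
      (Icc_mem_nhdsGE_of_mem hx))
    (by simp [h0, h0'])
    (fun x hx => by
      have hM := hg x (Ico_subset_Icc_self hx)
      have h1 : |d x| ≤ max |d x| |d' x| := le_max_left _ _
      have h2 : |d' x| ≤ max |d x| |d' x| := le_max_right _ _
      have h3 : (1 : ℝ) ≤ max 1 M := le_max_left _ _
      have h4 : |g x| ≤ max 1 M := hM.trans (le_max_right _ _)
      simp only [Prod.norm_def, Real.norm_eq_abs, abs_mul]
      refine max_le ?_ (mul_le_mul h4 h1 (abs_nonneg _) (by linarith))
      nlinarith [abs_nonneg (d' x)])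
  exact fun x hx => congrArg Prod.fst (hz x hx)

/-- The homogeneous Dirichlet problem `d'' = 0` has only the zero solution. -/
lemma eq_zero_of_second_deriv_eq_zero {a b : ℝ} (hab : a < b) {d d' : ℝ → ℝ}
    (hd : ∀ x ∈ Icc a b, HasDerivWithinAt d (d' x) (Icc a b) x)
    (hd' : ∀ x ∈ Icc a b, HasDerivWithinAt d' 0 (Icc a b) x)
    (ha : d a = 0) (hb : d b = 0) : ∀ x ∈ Icc a b, d x = 0 := by
  have hlin := eq_zero_of_second_order_ode (a := a) (b := b) (M := 0) (g := 0)
    (d := fun x => d x - d' a * (x - a)) (d' := fun x => d' x - d' a)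
    (fun x hx => (hd x hx).sub (by
      simpa using ((hasDerivWithinAt_id x (Icc a b)).sub_const a).const_mul (d' a)))
    (fun x hx => by simpa using (hd' x hx).sub_const (d' a))
    (by simp) (by simp [ha]) (by simp)
  have h0 : d' a = 0 := by
    have := hlin b (right_mem_Icc.2 hab.le)
    rw [hb, zero_sub, neg_eq_zero] at this
    exact (mul_eq_zero.1 this).resolve_right (by linarith)
  intro x hx
  have := hlin x hx
  rwa [h0, zero_mul, sub_zero] at this

/-- Two solutions of `-ψ'' = E ρ ψ` vanishing at the left endpoint are proportional. -/
lemma exists_eq_mul_of_second_order_ode {a b M : ℝ} {d d' e e' g : ℝ → ℝ}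
    (hd : ∀ x ∈ Icc a b, HasDerivWithinAt d (d' x) (Icc a b) x)
    (hd' : ∀ x ∈ Icc a b, HasDerivWithinAt d' (g x * d x) (Icc a b) x)
    (he : ∀ x ∈ Icc a b, HasDerivWithinAt e (e' x) (Icc a b) x)
    (he' : ∀ x ∈ Icc a b, HasDerivWithinAt e' (g x * e x) (Icc a b) x)
    (hg : ∀ x ∈ Icc a b, |g x| ≤ M) (hda : d a = 0) (hea : e a = 0)
    (hne : ∃ x ∈ Icc a b, e x ≠ 0) :
    ∃ c, ∀ x ∈ Icc a b, d x = c * e x := by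
  have hea' : e' a ≠ 0 := by
    intro h
    obtain ⟨x, hx, hex⟩ := hne
    exact hex (eq_zero_of_second_order_ode he he' hg hea h x hx)
  refine ⟨d' a / e' a, fun x hx => ?_⟩
  have := eq_zero_of_second_order_ode (a := a) (b := b) (M := M) (g := g)
    (d := fun x => d x - d' a / e' a * e x) (d' := fun x => d' x - d' a / e' a * e' x)
    (fun x hx => (hd x hx).sub ((he x hx).const_mul _))
    (fun x hx => ((hd' x hx).sub ((he' x hx).const_mul (d' a / e' a))).congr_deriv (by ring))
    hg (by simp [hda, hea]) (by field_simp; ring) x hx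
  linarith

lemma ContDiffOn.exists_hasDerivWithinAt_two {a b : ℝ} (hab : a < b) {f : ℝ → ℝ}
    (hf : ContDiffOn ℝ 2 f (Icc a b)) :
    ∃ f' : ℝ → ℝ, (∀ x ∈ Icc a b, HasDerivWithinAt f (f' x) (Icc a b) x) ∧
      ∀ x ∈ Icc a b, HasDerivWithinAt f' (iteratedDerivWithin 2 f (Icc a b) x) (Icc a b) x := by
  have hU := uniqueDiffOn_Icc hab
  refine ⟨derivWithin f (Icc a b), fun x hx =>
    ((hf.differentiableOn (by norm_num)) x hx).hasDerivWithinAt, fun x hx => ?_⟩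
  have h1 : iteratedDerivWithin 2 f (Icc a b) =
      derivWithin (derivWithin f (Icc a b)) (Icc a b) := by
    ext y
    rw [iteratedDerivWithin_succ, iteratedDerivWithin_one]
  rw [h1]
  exact ((hf.derivWithin hU (m := 1) (by norm_num)).differentiableOn
    (by norm_num) x hx).hasDerivWithinAt

end LinearODE

/-- Continuous functions on `[-L, L]`, to be equipped with the `L²` inner product. -/
def StringSpace (L : ℝ) : Type := C(Icc (-L) L, ℝ)

namespace StringSpace

open scoped Topology

variable {L : ℝ}

instance : AddCommGroup (StringSpace L) := inferInstanceAs (AddCommGroup C(Icc (-L) L, ℝ))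

instance : Module ℝ (StringSpace L) := inferInstanceAs (Module ℝ C(Icc (-L) L, ℝ))

/-- The identity from `C([-L, L])` to `StringSpace L`. -/
def ofC : C(Icc (-L) L, ℝ) →ₗ[ℝ] StringSpace L := LinearMap.id

/-- The identity from `StringSpace L` to `C([-L, L])`. -/
def toC : StringSpace L →ₗ[ℝ] C(Icc (-L) L, ℝ) := LinearMap.id

/-- The restriction to `[-L, L]` of a function which is continuous there. -/
def restrict (f : ℝ → ℝ) (hf : ContinuousOn f (Icc (-L) L)) : C(Icc (-L) L, ℝ) :=
  ⟨fun x => f x, hf.domRestrict⟩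

lemma restrict_apply {f : ℝ → ℝ} (hf : ContinuousOn f (Icc (-L) L)) (x : Icc (-L) L) :
    restrict f hf x = f x := rfl

lemma isCompact_setOf_lipschitz (B M : ℝ) : IsCompact {w : C(Icc (-L) L, ℝ) |
    (∀ x, |w x| ≤ B) ∧ ∀ x y, |w x - w y| ≤ M * |(x : ℝ) - y|} := by
  refine ArzelaAscoli.isCompact_of_equicontinuous _ ?_ ?_
  · have hcl : IsClosed {f : Icc (-L) L → ℝ | ∀ x y, |f x - f y| ≤ M * |(x : ℝ) - y|} := by
      simp only [ofPred_forall]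
      exact isClosed_iInter fun x => isClosed_iInter fun y =>
        isClosed_le (by fun_prop) (by fun_prop)
    convert (isCompact_univ_pi fun _ : Icc (-L) L => isCompact_Icc (a := -B) (b := B)).inter_right
      hcl using 1
    ext f
    simp only [mem_image, mem_inter_iff, mem_univ_pi, mem_Icc, ← abs_le]
    constructor
    · rintro ⟨w, hw, rfl⟩
      exact hw
    · intro hf
      have hLip : LipschitzWith M.toNNReal f := LipschitzWith.of_dist_le_mul fun x y =>
        (hf.2 x y).trans (mul_le_mul_of_nonneg_right (le_coe_toNNReal M) (abs_nonneg _))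
      exact ⟨⟨f, hLip.continuous⟩, hf, rfl⟩
  · refine (LipschitzWith.uniformEquicontinuous _ M.toNNReal fun w => ?_).equicontinuous
    exact LipschitzWith.of_dist_le_mul fun x y =>
      (w.2.2 x y).trans (mul_le_mul_of_nonneg_right (le_coe_toNNReal M) (abs_nonneg _))

variable [hL : Fact (0 < L)]

/-- The extension of a function on `[-L, L]` which is constant on both sides. -/
noncomputable def extend (f : StringSpace L) : ℝ → ℝ :=
  IccExtend (neg_le_self hL.out.le) (toC f)

lemma continuous_extend (f : StringSpace L) : Continuous (extend f) :=
  (toC f).continuous.Icc_extend'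

lemma continuous_mul_extend {r : ℝ → ℝ} (hr : Continuous r) (f : StringSpace L) :
    Continuous fun z => r z * extend f z := hr.mul (continuous_extend f)

lemma extend_add (f g : StringSpace L) (x : ℝ) : extend (f + g) x = extend f x + extend g x := rfl

lemma extend_smul (c : ℝ) (f : StringSpace L) (x : ℝ) : extend (c • f) x = c * extend f x := rfl

lemma extend_ofC {f : C(Icc (-L) L, ℝ)} {x : ℝ} (hx : x ∈ Icc (-L) L) :
    extend (ofC f) x = f ⟨x, hx⟩ := IccExtend_of_mem _ _ hx

lemma extend_restrict {f : ℝ → ℝ} (hf : ContinuousOn f (Icc (-L) L)) {x : ℝ}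
    (hx : x ∈ Icc (-L) L) : extend (ofC (restrict f hf)) x = f x := extend_ofC hx

lemma ext_extend {f g : StringSpace L} (h : EqOn (extend f) (extend g) (Icc (-L) L)) : f = g := by
  refine show toC f = toC g from ContinuousMap.ext fun x => ?_
  rw [← extend_ofC x.2, ← extend_ofC x.2]
  exact h x.2

/-- The `L²` inner product on `StringSpace L`. -/
@[reducible]
noncomputable def core : InnerProductSpace.Core ℝ (StringSpace L) where
  inner f g := ∫ x in (-L)..L, extend f x * extend g x
  conj_inner_symm f g := by simp only [mul_comm, conj_trivial]
  re_inner_nonneg f := integral_nonneg (neg_le_self hL.out.le) fun x _ => mul_self_nonneg _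
  add_left f g h := by
    simp only [extend_add, add_mul]
    exact integral_add
      (((continuous_extend f).mul (continuous_extend h)).intervalIntegrable _ _)
      (((continuous_extend g).mul (continuous_extend h)).intervalIntegrable _ _)
  smul_left f g c := by
    simp only [extend_smul, mul_assoc, integral_const_mul, conj_trivial]
  definite f hf := by
    refine ext_extend fun x hx => ?_
    by_contra hne
    have hpos : 0 < ∫ x in (-L)..L, extend f x * extend f x :=
      integral_pos (neg_lt_self hL.out)
        ((continuous_extend f).mul (continuous_extend f)).continuousOn
        (fun x _ => mul_self_nonneg _) ⟨x, hx, mul_self_pos.2 fun h => hne h⟩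
    exact hpos.ne' hf

noncomputable instance : NormedAddCommGroup (StringSpace L) := core.toNormedAddCommGroup

noncomputable instance : InnerProductSpace ℝ (StringSpace L) :=
  InnerProductSpace.ofCore core.toCore

lemma inner_def (f g : StringSpace L) :
    inner ℝ f g = ∫ x in (-L)..L, extend f x * extend g x := rfl

lemma inner_restrict {f g : ℝ → ℝ} (hf : ContinuousOn f (Icc (-L) L))
    (hg : ContinuousOn g (Icc (-L) L)) :
    inner ℝ (ofC (restrict f hf)) (ofC (restrict g hg)) = ∫ x in (-L)..L, f x * g x := by
  refine integral_congr fun x hx => ?_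
  rw [uIcc_of_le (neg_le_self hL.out.le)] at hx
  simp only [extend_restrict _ hx]

lemma norm_sq_eq (f : StringSpace L) : ‖f‖ ^ 2 = ∫ x in (-L)..L, extend f x ^ 2 := by
  rw [← real_inner_self_eq_norm_sq, inner_def]
  simp only [sq]

/-- The identity from the uniform norm to the `L²` norm. -/
noncomputable def ofCL : C(Icc (-L) L, ℝ) →L[ℝ] StringSpace L :=
  ofC.mkContinuous (√(2 * L)) fun f => by
    have hL0 := hL.out
    refine abs_le_of_sq_le_sq' ?_ (by positivity) |>.2
    rw [norm_sq_eq, mul_pow, Real.sq_sqrt (by positivity)]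
    calc ∫ x in (-L)..L, extend (ofC f) x ^ 2 ≤ ∫ _ in (-L)..L, ‖f‖ ^ 2 :=
          integral_mono_on (neg_le_self hL0.le)
            (((continuous_extend _).pow 2).intervalIntegrable _ _) (by simp) fun x hx => by
            rw [extend_ofC hx, ← sq_abs]
            exact pow_le_pow_left₀ (abs_nonneg _) (f.norm_coe_le_norm ⟨x, hx⟩) 2
      _ = 2 * L * ‖f‖ ^ 2 := by rw [integral_const, smul_eq_mul]; ring

@[simp]
lemma ofCL_apply (f : C(Icc (-L) L, ℝ)) : ofCL f = ofC f := rfl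

lemma integral_abs_mul_le {r : ℝ → ℝ} (hr : Continuous r) (f : StringSpace L) :
    ∫ x in (-L)..L, |r x * extend f x| ≤
      ‖ofC (restrict (L := L) (fun x => |r x|) hr.abs.continuousOn)‖ * ‖f‖ := by
  have hf : Continuous fun x => |extend f x| := (continuous_extend f).abs
  have hnorm : ‖ofC (restrict (L := L) (fun x => |extend f x|) hf.continuousOn)‖ = ‖f‖ := by
    rw [← sq_eq_sq₀ (norm_nonneg _) (norm_nonneg _), norm_sq_eq f, ← real_inner_self_eq_norm_sq,
      inner_restrict]
    simp only [abs_mul_abs_self, sq]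
  rw [← hnorm]
  refine le_of_eq_of_le ?_ (real_inner_le_norm _ _)
  rw [inner_restrict]
  simp only [abs_mul]

/-- The inverse of the string operator: the solution of `-w'' = r f` multiplied by `r`. -/
noncomputable def inverseOp {r : ℝ → ℝ} (hr : Continuous r) :
    StringSpace L →L[ℝ] C(Icc (-L) L, ℝ) :=
  LinearMap.mkContinuous
    { toFun := fun f => restrict (fun x => r x * bvpSol L (fun z => r z * extend f z) x)
        (hr.mul (continuous_bvpSol (continuous_mul_extend hr f))).continuousOn
      map_add' := fun f g => by
        ext x
        simp only [ContinuousMap.add_apply, restrict_apply, extend_add, mul_add]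
        rw [bvpSol_add (continuous_mul_extend hr f) (continuous_mul_extend hr g), mul_add]
      map_smul' := fun c f => by
        ext x
        simp only [ContinuousMap.smul_apply, restrict_apply, extend_smul, mul_left_comm _ c,
          bvpSol_const_mul, RingHom.id_apply, smul_eq_mul] }
    (‖restrict (L := L) r hr.continuousOn‖ *
      (4 * L * ‖ofC (restrict (L := L) (fun x => |r x|) hr.abs.continuousOn)‖)) fun f => by
    have hL0 := hL.out
    refine (ContinuousMap.norm_le _ (by positivity)).2 fun x => ?_
    have h1 : |r x| ≤ ‖restrict (L := L) r hr.continuousOn‖ :=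
      (restrict (L := L) r hr.continuousOn).norm_coe_le_norm x
    have h2 := abs_bvpSol_le hL0 (continuous_mul_extend hr f) x.2
    have h3 := integral_abs_mul_le hr f
    rw [mul_assoc]
    change ‖r x * bvpSol L (fun z => r z * extend f z) x‖ ≤ _
    rw [norm_mul]
    refine mul_le_mul h1 (h2.trans ?_) (norm_nonneg _) (norm_nonneg _)
    rw [mul_assoc (4 * L)]
    exact mul_le_mul_of_nonneg_left h3 (by positivity)

lemma inverseOp_apply {r : ℝ → ℝ} (hr : Continuous r) (f : StringSpace L) (x : Icc (-L) L) :
    inverseOp hr f x = r x * bvpSol L (fun z => r z * extend f z) x := rfl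

lemma inner_inverseOp {r : ℝ → ℝ} (hr : Continuous r) (f g : StringSpace L) :
    inner ℝ (ofCL (inverseOp hr f)) g = ∫ x in (-L)..L,
      bvpSlope L (fun z => r z * extend f z) x * bvpSlope L (fun z => r z * extend g z) x := by
  rw [← integral_bvpSol_mul hL.out (continuous_mul_extend hr f) (continuous_mul_extend hr g)]
  refine integral_congr fun x hx => ?_
  rw [uIcc_of_le (neg_le_self hL.out.le)] at hx
  simp only [ofCL_apply, extend_ofC hx, inverseOp_apply]
  ring

lemma inner_inverseOp_symm {r : ℝ → ℝ} (hr : Continuous r) (f g : StringSpace L) :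
    inner ℝ (ofCL (inverseOp hr f)) g = inner ℝ f (ofCL (inverseOp hr g)) := by
  rw [inner_inverseOp, real_inner_comm, inner_inverseOp]
  simp only [mul_comm]

lemma exists_subseq_tendsto_inverseOp {r : ℝ → ℝ} (hr : Continuous r) (u : ℕ → StringSpace L)
    (hu : ∀ n, ‖u n‖ ≤ 1) : ∃ g, ∃ φ : ℕ → ℕ, StrictMono φ ∧
      Tendsto (fun n => ofCL (inverseOp hr (u (φ n)))) atTop (𝓝 g) := by
  have hL0 := hL.out
  set c := ‖ofC (restrict (L := L) (fun x => |r x|) hr.abs.continuousOn)‖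
  have hint : ∀ n, ∫ z in (-L)..L, |r z * extend (u n) z| ≤ c := fun n =>
    (integral_abs_mul_le hr (u n)).trans (mul_le_of_le_one_right (norm_nonneg _) (hu n))
  have hcont : ∀ n, Continuous fun z => r z * extend (u n) z := fun n =>
    continuous_mul_extend hr (u n)
  set w : ℕ → C(Icc (-L) L, ℝ) := fun n =>
    restrict (bvpSol L fun z => r z * extend (u n) z) (continuous_bvpSol (hcont n)).continuousOn
  obtain ⟨w₀, -, φ, hφ, hlim⟩ :=
    (isCompact_setOf_lipschitz (L := L) (4 * L * c) (2 * c)).tendsto_subseq (x := w) fun n =>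
      ⟨fun x => (abs_bvpSol_le hL0 (hcont n) x.2).trans
        (mul_le_mul_of_nonneg_left (hint n) (by positivity)),
      fun x y => (abs_bvpSol_sub_le hL0 (hcont n) y.2 x.2).trans
        (mul_le_mul_of_nonneg_right (by linarith [hint n]) (abs_nonneg _))⟩
  refine ⟨ofCL (restrict (L := L) r hr.continuousOn * w₀), φ, hφ, ?_⟩
  exact (ofCL.continuous.tendsto _).comp (tendsto_const_nhds.mul hlim)

end StringSpace

section StringEigenfunctions

open StringSpace

variable {L : ℝ} [hL : Fact (0 < L)] {ρ : ℝ → ℝ}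

/-- The mode `√ρ · Ψ` as a continuous function on `[-L, L]`. -/
noncomputable def stringMode (hρ : Continuous ρ) {Ψ : ℝ → ℝ}
    (hΨ : ContDiffOn ℝ 2 Ψ (Icc (-L) L)) : C(Icc (-L) L, ℝ) :=
  restrict (fun x => √(ρ x) * Ψ x) (hρ.sqrt.continuousOn.mul hΨ.continuousOn)

lemma smul_inverseOp_stringMode (hρ : Continuous ρ) (hρpos : ∀ x ∈ Icc (-L) L, 0 < ρ x) {E : ℝ}
    {Ψ : ℝ → ℝ} (hΨ : ContDiffOn ℝ 2 Ψ (Icc (-L) L))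
    (heq : ∀ x ∈ Icc (-L) L, -(iteratedDerivWithin 2 Ψ (Icc (-L) L) x) = E * (ρ x * Ψ x))
    (ha : Ψ (-L) = 0) (hb : Ψ L = 0) :
    E • inverseOp hρ.sqrt (ofCL (stringMode hρ hΨ)) = stringMode hρ hΨ := by
  obtain ⟨Ψ', h1, h2⟩ := hΨ.exists_hasDerivWithinAt_two (neg_lt_self hL.out)
  set v : ℝ → ℝ := fun z => √(ρ z) * extend (ofCL (stringMode hρ hΨ)) z
  have hv : Continuous v := continuous_mul_extend hρ.sqrt _
  have hvx : ∀ x ∈ Icc (-L) L, v x = ρ x * Ψ x := fun x hx => by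
    change √(ρ x) * extend (ofC (restrict _ _)) x = _
    rw [extend_restrict _ hx, ← mul_assoc, Real.mul_self_sqrt (hρpos x hx).le]
  have hzero := eq_zero_of_second_deriv_eq_zero (neg_lt_self hL.out)
    (d := fun x => E * bvpSol L v x - Ψ x) (d' := fun x => E * bvpSlope L v x - Ψ' x)
    (fun x hx => ((hasDerivAt_bvpSol hv x).hasDerivWithinAt.const_mul E).sub (h1 x hx))
    (fun x hx => (((hasDerivAt_bvpSlope hv x).hasDerivWithinAt.const_mul E).sub
      (h2 x hx)).congr_deriv (by rw [hvx x hx]; linarith [heq x hx]))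
    (by rw [bvpSol_left, ha]; ring) (by rw [bvpSol_right hL.out hv, hb]; ring)
  ext x
  have := hzero x x.2
  change E * (√(ρ x) * bvpSol L v x) = √(ρ x) * Ψ x
  rw [← sub_eq_zero.1 this]
  ring

lemma inner_stringMode (hρ : Continuous ρ) (hρpos : ∀ x ∈ Icc (-L) L, 0 < ρ x) {Ψ Φ : ℝ → ℝ}
    (hΨ : ContDiffOn ℝ 2 Ψ (Icc (-L) L)) (hΦ : ContDiffOn ℝ 2 Φ (Icc (-L) L)) :
    inner ℝ (ofCL (stringMode hρ hΨ)) (ofCL (stringMode hρ hΦ)) =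
      ∫ x in (-L)..L, ρ x * Ψ x * Φ x := by
  refine (inner_restrict _ _).trans (integral_congr fun x hx => ?_)
  rw [uIcc_of_le (neg_le_self hL.out.le)] at hx
  linear_combination (Ψ x * Φ x) * Real.mul_self_sqrt (hρpos x hx).le

lemma eigenvalue_pos_of_smul_inverseOp {r : ℝ → ℝ} (hr : Continuous r) {E : ℝ}
    {f : C(Icc (-L) L, ℝ)} (hf : ofCL f ≠ 0) (heig : E • inverseOp hr (ofCL f) = f) : 0 < E := by
  have hnn : 0 ≤ inner ℝ (ofCL (inverseOp hr (ofCL f))) (ofCL f) := by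
    rw [inner_inverseOp]
    exact integral_nonneg (neg_le_self hL.out.le) fun x _ => mul_self_nonneg _
  have h : E * inner ℝ (ofCL (inverseOp hr (ofCL f))) (ofCL f) = ‖ofCL f‖ ^ 2 := by
    rw [← real_inner_smul_left, ← map_smul, heig, real_inner_self_eq_norm_sq]
  have hpos : 0 < ‖ofCL f‖ ^ 2 := pow_pos (norm_pos_iff.2 hf) 2
  exact pos_of_mul_pos_left (h ▸ hpos) hnn

/-- An eigenvector of the inverse operator has the form `√ρ · w` for a Dirichlet eigenfunction
`w` of the string. -/
lemma exists_eigenfunction_of_inverseOp (hρ : Continuous ρ) (hρpos : ∀ x ∈ Icc (-L) L, 0 < ρ x)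
    {h : StringSpace L} (hh : h ≠ 0) {μ : ℝ} (hμ : μ ≠ 0)
    (heig : ofCL (inverseOp hρ.sqrt h) = μ • h) :
    ∃ w : ℝ → ℝ, ContDiffOn ℝ 2 w (Icc (-L) L) ∧ (∃ x ∈ Icc (-L) L, w x ≠ 0) ∧
      (∀ x ∈ Icc (-L) L, -(iteratedDerivWithin 2 w (Icc (-L) L) x) = μ⁻¹ * (ρ x * w x)) ∧
      w (-L) = 0 ∧ w L = 0 ∧ ∀ x ∈ Icc (-L) L, √(ρ x) * w x = μ * extend h x := by
  have hv := continuous_mul_extend (L := L) hρ.sqrt h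
  have hw : ∀ x ∈ Icc (-L) L,
      √(ρ x) * bvpSol L (fun z => √(ρ z) * extend h z) x = μ * extend h x := fun x hx => by
    rw [← extend_smul, ← heig, ofCL_apply, extend_ofC hx, inverseOp_apply]
  refine ⟨bvpSol L fun z => √(ρ z) * extend h z, (contDiff_two_bvpSol hv).contDiffOn, ?_,
    fun x hx => ?_, bvpSol_left, bvpSol_right hL.out hv, hw⟩
  · by_contra! hzero
    refine hh (ext_extend fun x hx => ?_)
    have := hw x hx
    rw [hzero x hx, mul_zero] at this
    exact (mul_eq_zero.1 this.symm).resolve_left hμ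
  · rw [iteratedDerivWithin_two_bvpSol hL.out hv hx, neg_neg]
    have h1 := hw x hx
    have h2 := Real.mul_self_sqrt (hρpos x hx).le
    field_simp
    linear_combination -√(ρ x) * h1 + bvpSol L (fun z => √(ρ z) * extend h z) x * h2

/-- Two Dirichlet eigenfunctions for the same eigenvalue are proportional. -/
lemma exists_eq_mul_of_eigenfunction (hρ : Continuous ρ) {E : ℝ} {w Ψ : ℝ → ℝ}
    (hw : ContDiffOn ℝ 2 w (Icc (-L) L)) (hΨ : ContDiffOn ℝ 2 Ψ (Icc (-L) L))
    (hweq : ∀ x ∈ Icc (-L) L, -(iteratedDerivWithin 2 w (Icc (-L) L) x) = E * (ρ x * w x))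
    (hΨeq : ∀ x ∈ Icc (-L) L, -(iteratedDerivWithin 2 Ψ (Icc (-L) L) x) = E * (ρ x * Ψ x))
    (hwa : w (-L) = 0) (hΨa : Ψ (-L) = 0) (hne : ∃ x ∈ Icc (-L) L, w x ≠ 0) :
    ∃ c, ∀ x ∈ Icc (-L) L, Ψ x = c * w x := by
  obtain ⟨w', h1, h2⟩ := hw.exists_hasDerivWithinAt_two (neg_lt_self hL.out)
  obtain ⟨Ψ', h3, h4⟩ := hΨ.exists_hasDerivWithinAt_two (neg_lt_self hL.out)
  obtain ⟨M, hM⟩ := (isCompact_Icc (a := -L) (b := L)).exists_bound_of_continuousOn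
    (f := fun x => -(E * ρ x)) (by fun_prop)
  exact exists_eq_mul_of_second_order_ode (g := fun x => -(E * ρ x)) h3
    (fun x hx => (h4 x hx).congr_deriv (by linarith [hΨeq x hx])) h1
    (fun x hx => (h2 x hx).congr_deriv (by linarith [hweq x hx])) hM hΨa hwa hne

lemma stringIter_eqOn {ξ : ℝ → ℝ} (hρ : Continuous ρ) (hξ : ContinuousOn ξ (Icc (-L) L)) :
    EqOn (stringIter L ρ ξ) (extend (ofCL (inverseOp hρ.sqrt (ofCL (restrict ξ hξ)))))
      (Icc (-L) L) := fun x hx => by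
  rw [ofCL_apply, extend_ofC hx, inverseOp_apply]
  refine congrArg (√(ρ x) * ·) (bvpSol_congr hL.out (fun z hz => ?_) hx)
  change _ = √(ρ z) * extend (ofC (restrict ξ hξ)) z
  rw [extend_restrict hξ hz]

lemma continuousOn_stringIter {ξ : ℝ → ℝ} (hρ : Continuous ρ)
    (hξ : ContinuousOn ξ (Icc (-L) L)) : ContinuousOn (stringIter L ρ ξ) (Icc (-L) L) :=
  (continuous_extend _).continuousOn.congr (stringIter_eqOn hρ hξ)

lemma continuousOn_gram_schmidt {N : ℕ} {s : Set ℝ} {f g : Fin N → ℝ → ℝ}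
    {c : Fin N → Fin N → ℝ} (hg : ∀ j, ContinuousOn (g j) s)
    (h : ∀ j x, f j x = g j x - ∑ k ∈ Finset.Iio j, c j k * f k x) (j : Fin N) :
    ContinuousOn (f j) s := by
  induction j using WellFoundedLT.induction with
  | _ j ih =>
    rw [funext (h j)]
    exact (hg j).sub (continuousOn_finsetSum _ fun k hk =>
      (ih k (Finset.mem_Iio.1 hk)).const_mul _)

lemma abs_lt_inv_of_inner_stringMode_eq_zero (hρ : Continuous ρ)
    (hρpos : ∀ x ∈ Icc (-L) L, 0 < ρ x) {N : ℕ} {E : Fin N → ℝ} {Ψ : Fin N → ℝ → ℝ}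
    (hEmono : StrictMono E) (hE : ∀ i, 0 < E i)
    (hΨ : ∀ i, ContDiffOn ℝ 2 (Ψ i) (Icc (-L) L))
    (hΨeq : ∀ i, ∀ x ∈ Icc (-L) L,
      -(iteratedDerivWithin 2 (Ψ i) (Icc (-L) L) x) = E i * (ρ x * Ψ i x))
    (hΨa : ∀ i, Ψ i (-L) = 0) (hΨ0 : ∀ i, ofCL (stringMode hρ (hΨ i)) ≠ 0)
    (hother : ∀ (E' : ℝ) (ψ : ℝ → ℝ), ContDiffOn ℝ 2 ψ (Icc (-L) L) →
      (∃ x ∈ Icc (-L) L, ψ x ≠ 0) →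
      (∀ x ∈ Icc (-L) L, -(iteratedDerivWithin 2 ψ (Icc (-L) L) x) = E' * (ρ x * ψ x)) →
      ψ (-L) = 0 → ψ L = 0 → (∀ i, E' ≠ E i) → ∀ i, E i < E')
    (j : Fin N) {h : StringSpace L} (hh : h ≠ 0)
    (horth : ∀ i ≤ j, inner ℝ (ofCL (stringMode hρ (hΨ i))) h = 0) {μ : ℝ} (hμ : μ ≠ 0)
    (heig : ofCL (inverseOp hρ.sqrt h) = μ • h) : |μ| < (E j)⁻¹ := by
  obtain ⟨w, hw, hne, hweq, hwa, hwb, hwh⟩ :=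
    exists_eigenfunction_of_inverseOp hρ hρpos hh hμ heig
  suffices hlt : E j < μ⁻¹ by
    have hμpos : 0 < μ := inv_pos.1 ((hE j).trans hlt)
    rw [abs_of_pos hμpos]
    exact (lt_inv_comm₀ (hE j) hμpos).1 hlt
  by_cases hex : ∃ i, μ⁻¹ = E i
  · obtain ⟨i, hi⟩ := hex
    rw [hi] at hweq ⊢
    refine hEmono (lt_of_not_ge fun hij => hΨ0 i ?_)
    obtain ⟨c, hc⟩ := exists_eq_mul_of_eigenfunction hρ hw (hΨ i) hweq (hΨeq i) hwa (hΨa i) hne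
    have hpar : ofCL (stringMode hρ (hΨ i)) = (c * μ) • h := ext_extend fun x hx => by
      rw [extend_smul, mul_assoc, ← hwh x hx]
      change extend (ofC (restrict _ _)) x = _
      rw [extend_restrict _ hx, hc x hx]
      ring
    have h0 := horth i hij
    rw [hpar, real_inner_smul_left, mul_eq_zero, inner_self_eq_zero] at h0
    rw [hpar, h0.resolve_right hh, zero_smul]
  · exact hother μ⁻¹ w hw hne hweq hwa hwb (not_exists.1 hex) j

end StringEigenfunctions

open StringSpace

/-- Theorem 2 of the paper: iterating the inverse map together with Gram–Schmidt
orthogonalization on `N` starting functions whose overlap matrix with the first `N`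
eigenfunctions has nonzero leading principal minors produces, after normalization and
up to signs, the first `N` modes `√ρ · Ψ_j` of the string, uniformly on `[-L, L]`. -/
theorem stringIter_gram_schmidt_converges
    (L : ℝ) (hL : 0 < L) (ρ : ℝ → ℝ)
    (hρ : Continuous ρ) (hρpos : ∀ x ∈ Set.Icc (-L) L, 0 < ρ x)
    (N : ℕ) (hN : 0 < N) (E : Fin N → ℝ) (Ψ : Fin N → ℝ → ℝ)
    (hEmono : StrictMono E)
    (hΨsmooth : ∀ i, ContDiffOn ℝ 2 (Ψ i) (Set.Icc (-L) L))
    (hΨeq : ∀ i, ∀ x ∈ Set.Icc (-L) L,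
      -(iteratedDerivWithin 2 (Ψ i) (Set.Icc (-L) L) x) = E i * (ρ x * Ψ i x))
    (hΨa : ∀ i, Ψ i (-L) = 0) (hΨb : ∀ i, Ψ i L = 0)
    (hortho : ∀ i j,
      (∫ x in (-L)..L, ρ x * Ψ i x * Ψ j x) = if i = j then 1 else 0)
    (hother : ∀ (E' : ℝ) (ψ : ℝ → ℝ), ContDiffOn ℝ 2 ψ (Set.Icc (-L) L) →
      (∃ x ∈ Set.Icc (-L) L, ψ x ≠ 0) →
      (∀ x ∈ Set.Icc (-L) L,
        -(iteratedDerivWithin 2 ψ (Set.Icc (-L) L) x) = E' * (ρ x * ψ x)) →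
      ψ (-L) = 0 → ψ L = 0 → (∀ i, E' ≠ E i) → ∀ i, E i < E')
    (ξ₀ : Fin N → ℝ → ℝ)
    (hξ₀cont : ∀ j, ContinuousOn (ξ₀ j) (Set.Icc (-L) L))
    -- all leading principal minors of the overlap matrix
    -- `M i j = ∫ √ρ Ψ_i ξ₀^{(j)}` are nonzero
    (hminors : ∀ (m : ℕ) (hm : m ≤ N),
      Matrix.det (Matrix.of fun i j : Fin m =>
        ∫ x in (-L)..L,
          Real.sqrt (ρ x) * Ψ (Fin.castLE hm i) x * ξ₀ (Fin.castLE hm j) x) ≠ 0)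
    (ξ ξbar : ℕ → Fin N → ℝ → ℝ)
    (hinit : ∀ j, ξbar 0 j = ξ₀ j)
    (hstep : ∀ n j, ξ (n + 1) j = stringIter L ρ (ξbar n j))
    (hGS : ∀ n (j : Fin N) (x : ℝ),
      ξbar (n + 1) j x = ξ (n + 1) j x -
        ∑ k ∈ Finset.Iio j,
          ((∫ t in (-L)..L, ξbar (n + 1) k t * ξ (n + 1) j t) /
            (∫ t in (-L)..L, (ξbar (n + 1) k t) ^ 2)) * ξbar (n + 1) k x) :
    ∀ j : Fin N, ∃ s : ℕ → ℝ, (∀ n, s n = 1 ∨ s n = -1) ∧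
      TendstoUniformlyOn
        (fun n x => s n *
          (ξbar n j x / Real.sqrt (∫ t in (-L)..L, (ξbar n j t) ^ 2)))
        (fun x => Real.sqrt (ρ x) * Ψ j x) atTop (Set.Icc (-L) L) := by
  have : Fact (0 < L) := ⟨hL⟩
  have hr : Continuous fun x => √(ρ x) := hρ.sqrt
  have hcont : ∀ n j, ContinuousOn (ξbar n j) (Icc (-L) L) := by
    intro n
    induction n with
    | zero => exact fun j => hinit j ▸ hξ₀cont j
    | succ n ih =>
      exact continuousOn_gram_schmidt
        (fun j => hstep n j ▸ continuousOn_stringIter hρ (ih j)) (hGS n)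
  set x : ℕ → Fin N → C(Icc (-L) L, ℝ) := fun n j => restrict (ξbar n j) (hcont n j)
  set φ : Fin N → C(Icc (-L) L, ℝ) := fun i => stringMode hρ (hΨsmooth i)
  have hiter : ∀ n j, EqOn (ξ (n + 1) j) (extend (ofCL (inverseOp hr (ofCL (x n j)))))
      (Icc (-L) L) := fun n j => hstep n j ▸ stringIter_eqOn hρ (hcont n j)
  have hnorm : ∀ n j, ‖ofCL (x n j)‖ ^ 2 = ∫ t in (-L)..L, (ξbar n j t) ^ 2 := fun n j => by
    rw [← real_inner_self_eq_norm_sq]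
    exact (inner_restrict _ _).trans (by simp only [sq])
  have hx : IsGramSchmidtIteration ofCL
      (((inverseOp hr).comp ofCL : C(Icc (-L) L, ℝ) →L[ℝ] C(Icc (-L) L, ℝ)) :
        C(Icc (-L) L, ℝ) →ₗ[ℝ] C(Icc (-L) L, ℝ)) x := by
    intro n j
    have hinner : ∀ k, inner ℝ (ofCL (x (n + 1) k)) (ofCL (inverseOp hr (ofCL (x n j)))) =
        ∫ t in (-L)..L, ξbar (n + 1) k t * ξ (n + 1) j t := fun k => by
      refine integral_congr fun t ht => ?_
      rw [uIcc_of_le (by linarith)] at ht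
      rw [hiter n j ht]
      exact congrArg (· * _) (extend_restrict (hcont (n + 1) k) ht)
    ext t
    have ht : ξ (n + 1) j t = inverseOp hr (ofCL (x n j)) t :=
      (hiter n j t.2).trans (extend_ofC t.2)
    simp only [ContinuousLinearMap.coe_coe, ContinuousLinearMap.comp_apply, hinner, hnorm,
      ContinuousMap.sub_apply, ContinuousMap.sum_apply, ContinuousMap.smul_apply, smul_eq_mul,
      ← ht]
    exact hGS n j t
  have hφ : Orthonormal ℝ fun i => ofCL (φ i) := by
    rw [orthonormal_iff_ite]
    exact fun i j => (inner_stringMode hρ hρpos _ _).trans (hortho i j)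
  have heig : ∀ i, E i • inverseOp hr (ofCL (φ i)) = φ i := fun i =>
    smul_inverseOp_stringMode hρ hρpos (hΨsmooth i) (hΨeq i) (hΨa i) (hΨb i)
  have hE : ∀ i, 0 < E i := fun i => eigenvalue_pos_of_smul_inverseOp hr (hφ.ne_zero i) (heig i)
  intro j
  obtain ⟨s, hs, hlim⟩ := hx.tendsto_eigenvectors ofCL (inverseOp hr) (fun f g h => h)
    (inner_inverseOp_symm hr) (exists_subseq_tendsto_inverseOp hr) hφ hE
    (fun i => (eq_inv_smul_iff₀ (hE i).ne').2 (heig i))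
    (fun j h hh horth μ hμ hμh => abs_lt_inv_of_inner_stringMode_eq_zero hρ hρpos hEmono hE
      hΨsmooth hΨeq hΨa hφ.ne_zero hother j hh horth hμ hμh)
    (fun m hm => by
      have := hminors m hm
      convert this using 5 with i k
      exact (inner_restrict _ _).trans (by rw [hinit])) j
  refine ⟨fun _ => s, fun _ => hs, ?_⟩
  rw [ContinuousMap.tendsto_iff_tendstoUniformly] at hlim
  rw [tendstoUniformlyOn_iff_tendstoUniformly_comp_coe]
  convert hlim using 2 with n
  · ext t
    rw [← hnorm, Real.sqrt_sq (norm_nonneg _), div_eq_inv_mul]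
    rfl
  · rfl
end

section
/- Let α > −1 and let n ≥ 1 be an integer. Define on [−1/2, 1/2] the Borg density ρ(x) = (1+α)² / (1 + α(x + 1/2))⁴ and the function ψ_n(x) = ((2αx + α + 2)/√(2(α+1))) · sin( π(α+1) n (2x+1) / (2αx + α + 2) ). Then ψ_n is C² on [−1/2,1/2], satisfies ψ_n''(x) = −n²π² ρ(x) ψ_n(x) for all x ∈ [−1/2, 1/2], and ψ_n(−1/2) = ψ_n(1/2) = 0. In particular the Borg string has the same Dirichlet eigenvalues E_n = n²π² as the uniform string of unit density on [−1/2,1/2]. -/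
open Real Set

/-- The factor `2αx + α + 2` is positive on `[-1/2, 1/2]`. -/
lemma borg_factor_pos {α x : ℝ} (hα : -1 < α) (hx : x ∈ Set.Icc (-(1 : ℝ) / 2) (1 / 2)) :
    0 < 2 * α * x + α + 2 := by
  obtain ⟨h1, h2⟩ := hx
  nlinarith [mul_nonneg (by linarith : (0 : ℝ) ≤ α + 1) (by linarith : (0 : ℝ) ≤ x + 1 / 2)]

lemma hasDerivAt_borg_factor (α x : ℝ) :
    HasDerivAt (fun x : ℝ => 2 * α * x + α + 2) (2 * α) x := by
  simpa using (((hasDerivAt_id x).const_mul (2 * α)).add_const α).add_const 2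

lemma hasDerivAt_borg_phase (α k : ℝ) {x : ℝ} (hx : 2 * α * x + α + 2 ≠ 0) :
    HasDerivAt (fun x : ℝ => k * (2 * x + 1) / (2 * α * x + α + 2))
      (4 * k / (2 * α * x + α + 2) ^ 2) x := by
  have hnum : HasDerivAt (fun x : ℝ => k * (2 * x + 1)) (k * 2) x := by
    simpa using (((hasDerivAt_id x).const_mul 2).add_const 1).const_mul k
  refine (hnum.div (hasDerivAt_borg_factor α x) hx).congr_deriv ?_
  congr 1
  ring

lemma hasDerivAt_borg_mode (α k s : ℝ) {x : ℝ} (hx : 2 * α * x + α + 2 ≠ 0) :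
    HasDerivAt
      (fun x : ℝ => (2 * α * x + α + 2) / s * sin (k * (2 * x + 1) / (2 * α * x + α + 2)))
      ((2 * α * sin (k * (2 * x + 1) / (2 * α * x + α + 2)) +
        4 * k / (2 * α * x + α + 2) * cos (k * (2 * x + 1) / (2 * α * x + α + 2))) / s) x := by
  refine (((hasDerivAt_borg_factor α x).div_const s).mul
    (hasDerivAt_borg_phase α k hx).sin).congr_deriv ?_
  field_simp

lemma hasDerivAt_borg_mode_deriv (α k s : ℝ) {x : ℝ} (hx : 2 * α * x + α + 2 ≠ 0) :
    HasDerivAt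
      (fun x : ℝ => (2 * α * sin (k * (2 * x + 1) / (2 * α * x + α + 2)) +
        4 * k / (2 * α * x + α + 2) * cos (k * (2 * x + 1) / (2 * α * x + α + 2))) / s)
      (-(16 * k ^ 2 / (2 * α * x + α + 2) ^ 4) *
        ((2 * α * x + α + 2) / s * sin (k * (2 * x + 1) / (2 * α * x + α + 2)))) x := by
  have hphase := hasDerivAt_borg_phase α k hx
  refine (((hphase.sin.const_mul (2 * α)).add
    (((hasDerivAt_const x (4 * k)).div (hasDerivAt_borg_factor α x) hx).mul
      hphase.cos)).div_const s).congr_deriv ?_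
  rw [Pi.div_apply]
  generalize sin _ = S
  generalize cos _ = C
  field_simp
  ring

/-- The explicit modes of the Borg string: for the density
`ρ(x) = (1+α)²/(1+α(x+1/2))⁴` on `[-1/2, 1/2]`, the functions
`ψ_n(x) = ((2αx+α+2)/√(2(α+1))) sin(π(α+1)n(2x+1)/(2αx+α+2))` are `C²`, satisfy
`ψ_n'' = -n²π² ρ ψ_n` and vanish at `±1/2`: the Borg string has the same Dirichlet
eigenvalues `n²π²` as the uniform string of unit density. -/
theorem borg_string_explicit_modes (α : ℝ) (hα : -1 < α) (n : ℕ) (hn : 1 ≤ n) :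
    let ρ : ℝ → ℝ := fun x => (1 + α) ^ 2 / (1 + α * (x + 1 / 2)) ^ 4
    let ψ : ℝ → ℝ := fun x =>
      ((2 * α * x + α + 2) / Real.sqrt (2 * (α + 1))) *
        Real.sin (π * (α + 1) * n * (2 * x + 1) / (2 * α * x + α + 2))
    ContDiffOn ℝ 2 ψ (Set.Icc (-(1 : ℝ) / 2) (1 / 2)) ∧
    (∀ x ∈ Set.Icc (-(1 : ℝ) / 2) (1 / 2),
      deriv (deriv ψ) x = -((n : ℝ) ^ 2 * π ^ 2) * (ρ x * ψ x)) ∧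
    ψ (-(1 / 2)) = 0 ∧ ψ (1 / 2) = 0 := by
  intro ρ ψ
  refine ⟨?_, ?_, ?_, ?_⟩
  · have hD : ContDiffOn ℝ 2 (fun x : ℝ => 2 * α * x + α + 2)
        (Set.Icc (-(1 : ℝ) / 2) (1 / 2)) := by fun_prop
    have hN : ContDiffOn ℝ 2 (fun x : ℝ => π * (α + 1) * n * (2 * x + 1))
        (Set.Icc (-(1 : ℝ) / 2) (1 / 2)) := by fun_prop
    exact (hD.div_const _).mul (hN.div hD fun x hx => (borg_factor_pos hα hx).ne').sin
  · intro x hx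
    have hpos := borg_factor_pos hα hx
    have hopen : IsOpen {y : ℝ | 0 < 2 * α * y + α + 2} :=
      isOpen_lt continuous_const (by fun_prop)
    have hderiv := Filter.eventuallyEq_of_mem (hopen.mem_nhds hpos) fun y hy =>
      (hasDerivAt_borg_mode α (π * (α + 1) * n) √(2 * (α + 1))
        (LT.lt.ne' hy)).deriv
    refine (hderiv.deriv_eq.trans (hasDerivAt_borg_mode_deriv α _ _ hpos.ne').deriv).trans ?_
    have hρ : 1 + α * (x + 1 / 2) = (2 * α * x + α + 2) / 2 := by ring
    simp only [ρ, ψ, hρ]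
    rw [← mul_assoc (-((n : ℝ) ^ 2 * π ^ 2))]
    congr 1
    field_simp
    ring
  · simp only [ψ]
    norm_num
  · have harg : π * (α + 1) * n * (2 * (1 / 2) + 1) / (2 * α * (1 / 2) + α + 2) = n * π := by
      have : α + 1 ≠ 0 := by linarith
      rw [show 2 * α * (1 / 2) + α + 2 = 2 * (α + 1) by ring]
      field_simp
      ring
    simp only [ψ]
    rw [harg, sin_nat_mul_pi, mul_zero]
end
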